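/- arXiv:1108.5578 — 8 statements merged into one kernel-verified Lean document; each statement's English description precedes it below -/
import Mathlib

section
/- Let K be a compact metric space that is totally disconnected. Then the generic f ∈ C(K) is injective, i.e. the set of injective continuous functions f : K → ℝ is co-meager in C(K). -/
open MeasureTheory Topology Metric Set

/-- On a compact totally separated space, the locally constant real functions are dense among
the continuous ones. -/
lemma LocallyConstant.denseRange_toContinuousMap_real {X : Type*} [TopologicalSpace X]
    [CompactSpace X] [TotallySeparatedSpace X] :
    DenseRange (fun g : LocallyConstant X ℝ ↦ (g : C(X, ℝ))) := by
  have h := ContinuousMap.subalgebra_topologicalClosure_eq_top_of_separatesPoints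
    (LocallyConstant.toContinuousMapAlgHom ℝ : LocallyConstant X ℝ →ₐ[ℝ] C(X, ℝ)).range
    (LocallyConstant.separatesPoints_range_toContinuousMapAlgHom ℝ)
  intro f
  have hf : f ∈ (LocallyConstant.toContinuousMapAlgHom ℝ :
      LocallyConstant X ℝ →ₐ[ℝ] C(X, ℝ)).range.topologicalClosure := h ▸ Algebra.mem_top
  exact hf

/-- The continuous functions separating two compact sets form an open set. -/
lemma isOpen_setOf_forall_ne_of_isCompact {X G : Type*} [TopologicalSpace X]
    [AddCommGroup G] [TopologicalSpace G] [IsTopologicalAddGroup G] [T1Space G] {U V : Set X}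
    (hU : IsCompact U) (hV : IsCompact V) :
    IsOpen {f : C(X, G) | ∀ x ∈ U, ∀ y ∈ V, f x ≠ f y} := by
  have ho : IsOpen {F : C(X × X, G) | MapsTo F (U ×ˢ V) {0}ᶜ} :=
    ContinuousMap.isOpen_setOfPred_mapsTo (hU.prod hV) isOpen_compl_singleton
  have hc : Continuous fun f : C(X, G) ↦
      f.comp ContinuousMap.fst - f.comp (ContinuousMap.snd : C(X × X, X)) :=
    (ContinuousMap.continuous_precomp _).sub (ContinuousMap.continuous_precomp _)
  convert ho.preimage hc using 1
  ext f
  simp only [mem_ofPred_eq, mem_preimage, MapsTo, Prod.forall, mem_prod, mem_compl_iff,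
    mem_singleton_iff, ContinuousMap.sub_apply, ContinuousMap.comp_apply, ContinuousMap.fst_apply,
    ContinuousMap.snd_apply, sub_eq_zero]
  exact ⟨fun h x y hxy ↦ h x hxy.1 y hxy.2, fun h x hx y hy ↦ h x y ⟨hx, hy⟩⟩

/-- On a compact totally separated space, the continuous real functions separating a clopen set
from its complement are dense. -/
lemma dense_setOf_forall_ne_of_isClopen {X : Type*} [TopologicalSpace X]
    [CompactSpace X] [TotallySeparatedSpace X] {U : Set X} (hU : IsClopen U) :
    Dense {f : C(X, ℝ) | ∀ x ∈ U, ∀ y ∈ Uᶜ, f x ≠ f y} := by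
  refine dense_closure.1 (LocallyConstant.denseRange_toContinuousMap_real.mono ?_)
  rintro _ ⟨g, rfl⟩
  let χ : C(X, ℝ) := LocallyConstant.charFn ℝ hU
  have hc : Continuous fun t : ℝ ↦ (g : C(X, ℝ)) + t • χ := by fun_prop
  have ht : Filter.Tendsto (fun t : ℝ ↦ (g : C(X, ℝ)) + t • χ) (𝓝[≠] 0) (𝓝 (g : C(X, ℝ))) := by
    simpa using (hc.tendsto 0).mono_left nhdsWithin_le_nhds
  have hfin : (image2 (fun a b ↦ b - a) (range g) (range g)).Finite :=
    g.range_finite.image2 _ g.range_finite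
  have hev : ∀ᶠ t in 𝓝[≠] (0 : ℝ), t ∉ image2 (fun a b ↦ b - a) (range g) (range g) :=
    Filter.mem_of_superset (nhdsNE_of_nhdsNE_sdiff_finite Filter.univ_mem hfin) fun _ h ↦ h.2
  refine mem_closure_of_tendsto ht (hev.mono fun t ht x hx y hy hxy ↦ ht ?_)
  refine ⟨g x, mem_range_self x, g y, mem_range_self y, ?_⟩
  have h1 : χ x = 1 := (LocallyConstant.charFn_eq_one ℝ x hU).2 hx
  have h0 : χ y = 0 := (LocallyConstant.charFn_eq_zero ℝ y hU).2 hy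
  have hxy' : g x + t * χ x = g y + t * χ y := hxy
  rw [h1, h0] at hxy'
  change g y - g x = t
  linarith

/-- If `K` is a compact metric space which is totally disconnected, then the
generic `f ∈ C(K)` is injective: the set of injective continuous functions `f : K → ℝ` is
co-meager in `C(K)`. -/
theorem generic_injective_of_totallyDisconnected
    {K : Type*} [MetricSpace K] [CompactSpace K] [TotallyDisconnectedSpace K] :
    {f : C(K, ℝ) | Function.Injective f} ∈ residual C(K, ℝ) := by
  have : Countable (TopologicalSpace.Clopens K) :=
    TopologicalSpace.Clopens.countable_iff_secondCountable.2 inferInstance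
  have h : ∀ U : TopologicalSpace.Clopens K,
      ∀ᶠ f in residual C(K, ℝ), ∀ x ∈ (U : Set K), ∀ y ∈ (U : Set K)ᶜ, f x ≠ f y := fun U ↦
    residual_of_dense_open
      (isOpen_setOf_forall_ne_of_isCompact U.isClopen.isClosed.isCompact
        U.isClopen.compl.isClosed.isCompact)
      (dense_setOf_forall_ne_of_isClopen U.isClopen)
  filter_upwards [eventually_countable_forall.2 h] with f hf x y hxy
  by_contra hne
  obtain ⟨U, hU, hx, hy⟩ := exists_isClopen_of_totally_separated hne
  exact hf ⟨U, hU⟩ x hx y hy hxy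
end

section
/- Let K₁ ⊆ K₂ be compact metric spaces and let R : C(K₂) → C(K₁) be the restriction map R(f) = f|_{K₁}. (i) If 𝓕₂ ⊆ C(K₂) is of second category (resp. co-meager) in C(K₂), then R(𝓕₂) is of second category (resp. co-meager) in C(K₁). (ii) If 𝓕₁ ⊆ C(K₁) is of second category (resp. co-meager) in C(K₁), then R⁻¹(𝓕₁) is of second category (resp. co-meager) in C(K₂). -/
open MeasureTheory Topology Metric Set

/-- Under a continuous open map from a second countable space, a dense open set is dense in almost
every fibre, in the sense of Baire category. -/
theorem eventually_residual_dense_preimage_fiber {X Y : Type*} [TopologicalSpace X]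
    [SecondCountableTopology X] [TopologicalSpace Y] {f : X → Y} (hc : Continuous f)
    (ho : IsOpenMap f) {U : Set X} (hU : IsOpen U) (hd : Dense U) :
    ∀ᶠ y in residual Y, Dense ((↑) ⁻¹' U : Set (f ⁻¹' {y})) := by
  have hB := TopologicalSpace.isBasis_countableBasis X
  have key : ∀ᶠ y in residual Y, ∀ B ∈ TopologicalSpace.countableBasis X,
      y ∈ f '' B → y ∈ f '' (B ∩ U) := by
    rw [eventually_countable_ball (TopologicalSpace.countable_countableBasis X)]
    intro B hBmem
    have hBo := hB.isOpen hBmem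
    filter_upwards [coborder_mem_residual (ho _ (hBo.inter hU)).isLocallyClosed] with y hy hyB
    by_contra hyn
    exact hy ⟨image_closure_subset_closure_image hc
      (image_mono (hd.open_subset_closure_inter hBo) hyB), hyn⟩
  filter_upwards [key] with y hy
  rw [dense_iff_inter_open]
  rintro _ ⟨V, hV, rfl⟩ ⟨⟨x, hxy⟩, hxV⟩
  obtain ⟨B, hBmem, hxB, hBV⟩ := hB.exists_subset_of_mem_open hxV hV
  obtain ⟨z, ⟨hzB, hzU⟩, hzy⟩ := hy B hBmem ⟨x, hxB, hxy⟩
  exact ⟨⟨z, hzy⟩, hBV hzB, hzU⟩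

/-- A continuous open surjection from a complete second countable metric space maps residual sets
to residual sets. -/
theorem IsOpenMap.image_mem_residual {X Y : Type*} [MetricSpace X] [CompleteSpace X]
    [SecondCountableTopology X] [TopologicalSpace Y] [T1Space Y] {f : X → Y} (ho : IsOpenMap f)
    (hc : Continuous f) (hf : Function.Surjective f) {s : Set X} (hs : s ∈ residual X) :
    f '' s ∈ residual Y := by
  obtain ⟨S, hSo, hSd, hSc, hSs⟩ := mem_residual_iff.1 hs
  have key : ∀ᶠ y in residual Y, ∀ U ∈ S, Dense ((↑) ⁻¹' U : Set (f ⁻¹' {y})) :=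
    (eventually_countable_ball hSc).2 fun U hU ↦
      eventually_residual_dense_preimage_fiber hc ho (hSo U hU) (hSd U hU)
  filter_upwards [key] with y hy
  have : CompleteSpace (f ⁻¹' {y}) := (isClosed_singleton.preimage hc).completeSpace_coe
  have : Nonempty (f ⁻¹' {y}) := let ⟨x, hx⟩ := hf y; ⟨⟨x, hx⟩⟩
  obtain ⟨⟨x, hxy⟩, hx⟩ := (dense_biInter_of_isOpen
    (fun U hU ↦ (hSo U hU).preimage continuous_subtype_val) hSc hy).nonempty
  exact ⟨x, hSs fun U hU ↦ mem_iInter₂.1 hx U hU, hxy⟩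

/-- Restriction of continuous real-valued functions to a closed subset of a compact Hausdorff space
is an open map. -/
theorem ContinuousMap.isOpenMap_restrict {X : Type*} [TopologicalSpace X] [CompactSpace X]
    [T2Space X] {K : Set X} (hK : IsClosed K) :
    IsOpenMap (fun f : C(X, ℝ) => f.restrict K) := by
  have : CompactSpace K := isCompact_iff_compactSpace.1 hK.isCompact
  let R : C(X, ℝ) →L[ℝ] C(K, ℝ) :=
    { toFun := fun f => f.restrict K
      map_add' := fun _ _ => rfl
      map_smul' := fun _ _ => rfl
      cont := ContinuousMap.continuous_restrict K }
  exact R.isOpenMap fun f => f.exists_restrict_eq hK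

/-- Let `K₁ ⊆ K₂` be compact metric spaces and let
`R : C(K₂) → C(K₁)`, `R(f) = f|_{K₁}` be the restriction map.
(i) If `𝓕₂ ⊆ C(K₂)` is of second category (resp. co-meager) in `C(K₂)` then `R(𝓕₂)` is of
second category (resp. co-meager) in `C(K₁)`.
(ii) If `𝓕₁ ⊆ C(K₁)` is of second category (resp. co-meager) in `C(K₁)` then `R⁻¹(𝓕₁)` is of
second category (resp. co-meager) in `C(K₂)`. -/
theorem restrictionMap_secondCategory_and_comeager
    {K₂ : Type*} [MetricSpace K₂] [CompactSpace K₂] (K₁ : Set K₂) (hK₁ : IsCompact K₁) :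
    (∀ 𝓕₂ : Set C(K₂, ℝ), ¬ IsMeagre 𝓕₂ →
      ¬ IsMeagre ((fun f : C(K₂, ℝ) => f.restrict K₁) '' 𝓕₂)) ∧
    (∀ 𝓕₂ : Set C(K₂, ℝ), 𝓕₂ ∈ residual C(K₂, ℝ) →
      (fun f : C(K₂, ℝ) => f.restrict K₁) '' 𝓕₂ ∈ residual C(K₁, ℝ)) ∧
    (∀ 𝓕₁ : Set C(K₁, ℝ), ¬ IsMeagre 𝓕₁ →
      ¬ IsMeagre ((fun f : C(K₂, ℝ) => f.restrict K₁) ⁻¹' 𝓕₁)) ∧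
    (∀ 𝓕₁ : Set C(K₁, ℝ), 𝓕₁ ∈ residual C(K₁, ℝ) →
      (fun f : C(K₂, ℝ) => f.restrict K₁) ⁻¹' 𝓕₁ ∈ residual C(K₂, ℝ)) := by
  have hc := ContinuousMap.continuous_restrict (Y := ℝ) K₁
  have ho := ContinuousMap.isOpenMap_restrict hK₁.isClosed
  have hs : Function.Surjective (fun f : C(K₂, ℝ) => f.restrict K₁) :=
    fun f => f.exists_restrict_eq hK₁.isClosed
  refine ⟨fun 𝓕 h hm => h ((hm.preimage_of_isOpenMap hc ho).mono (subset_preimage_image _ _)),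
    fun 𝓕 h => ho.image_mem_residual hc hs h, fun 𝓕 h hm => h ?_,
    fun 𝓕 h => tendsto_residual_of_isOpenMap hc ho h⟩
  filter_upwards [ho.image_mem_residual hc hs hm]
  rintro _ ⟨f, hf, rfl⟩
  exact hf
end

section
/- Let K be a compact metric space and d ∈ ℝ. Then the set Δ = {(f, y) ∈ C(K) × ℝ : dim_H f⁻¹(y) < d} is a Borel subset of C(K) × ℝ, where dim_H denotes Hausdorff dimension with the convention dim_H ∅ = −1. -/
open MeasureTheory Topology Metric Set
open scoped Classical

/-- Hausdorff dimension of a subset of a metric space, as an extended real number, with the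
convention that the empty set has dimension `-1`. -/
noncomputable def hdim {X : Type*} [EMetricSpace X] (s : Set X) : EReal :=
  if s = ∅ then -1 else (dimH s : EReal)

open scoped ENNReal NNReal

theorem hdim_lt_coe_iff {X : Type*} [EMetricSpace X] (s : Set X) (d : ℝ) :
    hdim s < (d : EReal) ↔ (s = ∅ ∧ -1 < d) ∨ dimH s < ENNReal.ofReal d := by
  have hneg : (-1 : EReal) < d ↔ -1 < d := by
    rw [← EReal.coe_lt_coe_iff]; rfl
  unfold hdim
  split_ifs with hs
  · subst hs
    rw [hneg, dimH_empty, ENNReal.ofReal_pos]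
    constructor
    · exact fun h => Or.inl ⟨rfl, h⟩
    · rintro (h | h)
      · exact h.2
      · linarith
  · simp only [hs, false_and, false_or]
    rw [← EReal.coe_ennreal_lt_coe_ennreal_iff, EReal.coe_ennreal_ofReal]
    rcases le_total 0 d with hd | hd
    · rw [max_eq_left hd]
    · rw [max_eq_right hd]
      have h0 : (0 : EReal) ≤ (dimH s : EReal) := EReal.coe_ennreal_nonneg _
      exact iff_of_false (not_lt.2 ((EReal.coe_nonpos.2 hd).trans h0)) (not_lt.2 h0)

/-- Every set can be enlarged to an open set with arbitrarily small increase of the `q`-th power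
of the diameter. -/
theorem exists_isOpen_superset_ediam_rpow_le {X : Type*} [PseudoEMetricSpace X] {q : ℝ}
    (hq : 0 < q) (t : Set X) (ht : ediam t ^ q ≠ ∞) {ε : ℝ≥0∞} (hε : ε ≠ 0) :
    ∃ U, IsOpen U ∧ t ⊆ U ∧ ediam U ^ q ≤ ediam t ^ q + ε := by
  have hcont : Filter.Tendsto (fun δ : ℝ≥0 => (ediam t + 2 * (δ : ℝ≥0∞)) ^ q)
      (𝓝[>] 0) (𝓝 (ediam t ^ q)) := by
    have h : Continuous fun δ : ℝ≥0 => (ediam t + 2 * (δ : ℝ≥0∞)) ^ q := by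
      refine ENNReal.continuous_rpow_const.comp (continuous_const.add ?_)
      exact (ENNReal.continuous_const_mul (by simp)).comp ENNReal.continuous_coe
    simpa using (h.tendsto 0).mono_left nhdsWithin_le_nhds
  obtain ⟨δ, hδ, hδ0⟩ := ((hcont.eventually_lt_const
    (ENNReal.lt_add_right ht hε)).and self_mem_nhdsWithin).exists
  exact ⟨thickening δ t, isOpen_thickening, self_subset_thickening (by exact_mod_cast hδ0) t,
    (ENNReal.rpow_le_rpow (ediam_thickening_le δ) hq.le).trans hδ.le⟩

theorem hausdorffMeasure_eq_zero_iff_exists_open_cover {X : Type*} [EMetricSpace X]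
    [MeasurableSpace X] [BorelSpace X] {q : ℝ} (hq : 0 < q) (s : Set X) :
    μH[q] s = 0 ↔ ∀ n : ℕ, ∃ U : ℕ → Set X, (∀ i, IsOpen (U i)) ∧
      ∑' i, ediam (U i) ^ q ≤ (n : ℝ≥0∞)⁻¹ ∧ s ⊆ ⋃ i, U i := by
  have hsup (t : Set X) : ⨆ _ : t.Nonempty, ediam t ^ q = ediam t ^ q := by
    rcases t.eq_empty_or_nonempty with rfl | h
    · simp [hq]
    · simp [h]
  simp only [Measure.hausdorffMeasure_apply, hsup, ENNReal.iSup_eq_zero]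
  constructor
  · intro h n
    have hn : (n : ℝ≥0∞)⁻¹ ≠ 0 := by simp
    have hn2 : (n : ℝ≥0∞)⁻¹ / 2 ≠ 0 := (ENNReal.half_pos hn).ne'
    have hlt := (h 1 one_pos).trans_lt (pos_iff_ne_zero.2 hn2)
    simp only [iInf_lt_iff] at hlt
    obtain ⟨t, hst, -, hsum⟩ := hlt
    obtain ⟨ε, hε, hεsum⟩ := ENNReal.exists_pos_sum_of_countable' hn2 ℕ
    have hfin (i : ℕ) : ediam (t i) ^ q ≠ ∞ := ENNReal.ne_top_of_tsum_ne_top hsum.ne_top i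
    choose U hUo htU hU using fun i =>
      exists_isOpen_superset_ediam_rpow_le hq (t i) (hfin i) (hε i).ne'
    refine ⟨U, hUo, ?_, hst.trans (iUnion_mono htU)⟩
    calc ∑' i, ediam (U i) ^ q ≤ ∑' i, (ediam (t i) ^ q + ε i) := ENNReal.tsum_le_tsum hU
      _ = ∑' i, ediam (t i) ^ q + ∑' i, ε i := ENNReal.tsum_add
      _ ≤ (n : ℝ≥0∞)⁻¹ / 2 + (n : ℝ≥0∞)⁻¹ / 2 := add_le_add hsum.le hεsum.le
      _ = (n : ℝ≥0∞)⁻¹ := ENNReal.add_halves _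
  · intro h r hr
    refine le_antisymm (le_of_forall_gt fun ε hε => ?_) bot_le
    have hpos : min (r ^ q) ε ≠ 0 :=
      (lt_min (ENNReal.rpow_pos_of_nonneg hr hq.le) hε).ne'
    obtain ⟨n, hn⟩ := ENNReal.exists_inv_nat_lt hpos
    obtain ⟨U, -, hsum, hU⟩ := h n
    refine lt_of_le_of_lt ?_ (hn.trans_le (min_le_right _ _))
    refine iInf_le_of_le U (iInf_le_of_le hU (iInf_le_of_le (fun i => ?_) hsum))
    rw [← ENNReal.rpow_le_rpow_iff hq]
    exact ((ENNReal.le_tsum i).trans hsum).trans (hn.le.trans (min_le_left _ _))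

theorem isOpen_setOf_levelSet_subset {K Y : Type*} [TopologicalSpace K] [CompactSpace K]
    [TopologicalSpace Y] [T2Space Y] {V : Set K} (hV : IsOpen V) :
    IsOpen {p : C(K, Y) × Y | p.1 ⁻¹' {p.2} ⊆ V} := by
  have hC : IsClosed {x : K × (C(K, Y) × Y) | x.2.1 x.1 = x.2.2 ∧ x.1 ∉ V} := by
    refine (isClosed_eq ?_ ?_).inter (hV.isClosed_compl.preimage continuous_fst)
    · fun_prop
    · fun_prop
  have := isClosedMap_snd_of_compactSpace _ hC
  rw [← isOpen_compl_iff] at this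
  convert this using 1
  ext p
  simp [Set.subset_def]

theorem dimH_lt_iff_exists_rat {X : Type*} [EMetricSpace X] [MeasurableSpace X] [BorelSpace X]
    (s : Set X) (d : ℝ≥0∞) :
    dimH s < d ↔ ∃ q : ℚ, (0 < q ∧ ENNReal.ofReal q < d) ∧ μH[(q : ℝ)] s = 0 := by
  constructor
  · intro h
    obtain ⟨q, -, h₁, h₂⟩ := ENNReal.lt_iff_exists_rat_btwn.1 h
    have hq : 0 < (q : ℝ) := by simpa using bot_le.trans_lt h₁
    refine ⟨q, ⟨by exact_mod_cast hq, h₂⟩, ?_⟩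
    simpa [Real.coe_toNNReal _ hq.le] using hausdorffMeasure_of_dimH_lt h₁
  · rintro ⟨q, ⟨hq, hqd⟩, h⟩
    have hq₀ : 0 ≤ (q : ℝ) := by exact_mod_cast hq.le
    refine lt_of_le_of_lt (dimH_le_of_hausdorffMeasure_ne_top (d := Real.toNNReal q) ?_) hqd
    simp [Real.coe_toNNReal _ hq₀, h]

/-- Let `K` be a compact metric space and `d ∈ ℝ`. Then
`Δ = {(f, y) ∈ C(K) × ℝ : dim_H f⁻¹(y) < d}` is a Borel subset of `C(K) × ℝ`. -/
theorem borel_levelSet_dimH_lt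
    {K : Type*} [MetricSpace K] [CompactSpace K] (d : ℝ) :
    MeasurableSet[borel (C(K, ℝ) × ℝ)]
      {p : C(K, ℝ) × ℝ | hdim (p.1 ⁻¹' {p.2}) < (d : EReal)} := by
  borelize K
  borelize (C(K, ℝ) × ℝ)
  simp only [hdim_lt_coe_iff, dimH_lt_iff_exists_rat]
  rw [ofPred_or, ofPred_and]
  refine MeasurableSet.union (MeasurableSet.inter ?_ (MeasurableSet.const _)) ?_
  · simp only [← subset_empty_iff]
    exact (isOpen_setOf_levelSet_subset isOpen_empty).measurableSet
  · rw [ofPred_exists]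
    refine MeasurableSet.iUnion fun q => ?_
    by_cases hq : 0 < q ∧ ENNReal.ofReal q < ENNReal.ofReal d
    · simp only [hq, true_and, and_self,
        hausdorffMeasure_eq_zero_iff_exists_open_cover (Rat.cast_pos.2 hq.1)]
      rw [ofPred_forall]
      refine MeasurableSet.iInter fun n => ?_
      rw [ofPred_exists]
      refine (isOpen_iUnion fun U => ?_).measurableSet
      by_cases hU : (∀ i, IsOpen (U i)) ∧ ∑' i, ediam (U i) ^ (q : ℝ) ≤ (n : ℝ≥0∞)⁻¹
      · simpa [hU.1, hU.2] using isOpen_setOf_levelSet_subset (isOpen_iUnion hU.1)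
      · simp only [← and_assoc, hU, false_and, ofPred_false, isOpen_empty]
    · simp only [hq, false_and, ofPred_false, MeasurableSet.empty]
end

section
/- Let K be a compact metric space such that for every x ∈ K and every r > 0 the closed ball B(x, r) is not totally disconnected (equivalently, every closed ball has positive topological dimension). Let 𝒞 denote the set of connected components of K. Then for the generic f ∈ C(K) one has ⋃_{C ∈ 𝒞} int f(C) = int f(K), where int denotes the interior in ℝ. -/
open MeasureTheory Topology Metric Set

/-- The functions whose range contains `[p, q]` and for which some level `y ∈ [p, q]` is not
crossed by the function inside any connected component. -/
def uncrossedLevelSet (K : Type*) [TopologicalSpace K] (p q : ℝ) : Set C(K, ℝ) :=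
  {f | Icc p q ⊆ range f ∧
    ∃ y : Icc p q, ∀ a b : K, b ∈ connectedComponent a → (y : ℝ) ≤ f a ∨ f b ≤ y}

theorem isClosed_setOf_mem_range {K : Type*} [TopologicalSpace K] [CompactSpace K]
    [LocallyCompactSpace K] (y : ℝ) : IsClosed {f : C(K, ℝ) | y ∈ range f} := by
  have hc : IsClosed {z : C(K, ℝ) × K | z.1 z.2 = y} :=
    isClosed_eq (by fun_prop) continuous_const
  convert isClosedMap_fst_of_compactSpace _ hc using 1
  ext f
  simp

theorem isClosed_uncrossedLevelSet (K : Type*) [TopologicalSpace K] [CompactSpace K]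
    [LocallyCompactSpace K] (p q : ℝ) : IsClosed (uncrossedLevelSet K p q) := by
  have hr : IsClosed {f : C(K, ℝ) | Icc p q ⊆ range f} := by
    have : {f : C(K, ℝ) | Icc p q ⊆ range f} = ⋂ y ∈ Icc p q, {f : C(K, ℝ) | y ∈ range f} := by
      ext f
      simp only [mem_iInter, mem_ofPred_eq]
      rfl
    rw [this]
    exact isClosed_biInter fun y _ => isClosed_setOf_mem_range y
  have hc : IsClosed {z : C(K, ℝ) × Icc p q |
      ∀ a b : K, b ∈ connectedComponent a → (z.2 : ℝ) ≤ z.1 a ∨ z.1 b ≤ z.2} := by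
    simp only [ofPred_forall]
    refine isClosed_iInter fun a => isClosed_iInter fun b => isClosed_iInter fun _ => ?_
    have hev (c : K) : Continuous fun z : C(K, ℝ) × Icc p q => z.1 c := by fun_prop
    have hlevel : Continuous fun z : C(K, ℝ) × Icc p q => (z.2 : ℝ) := by fun_prop
    exact (isClosed_le hlevel (hev a)).union (isClosed_le (hev b) hlevel)
  convert hr.inter (isClosedMap_fst_of_compactSpace _ hc) using 1
  ext f
  simp [uncrossedLevelSet]

/-- Near every point there are two distinct points of one connected component at which a given
continuous function is almost constant. -/
theorem exists_ne_mem_connectedComponent_abs_sub_lt {K : Type*} [MetricSpace K]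
    (hK : ∀ (x : K) (r : ℝ), 0 < r → ¬ IsTotallyDisconnected (closedBall x r))
    (f : C(K, ℝ)) (x : K) {δ : ℝ} (hδ : 0 < δ) :
    ∃ a b : K, a ≠ b ∧ b ∈ connectedComponent a ∧ |f a - f x| < δ ∧ |f b - f x| < δ := by
  obtain ⟨r, hr, hball⟩ := Metric.nhds_basis_closedBall.mem_iff.1
    (f.continuous.continuousAt.preimage_mem_nhds (Metric.ball_mem_nhds (f x) hδ))
  have h := hK x r hr
  simp only [IsTotallyDisconnected, not_forall, Set.not_subsingleton_iff] at h
  obtain ⟨t, ht, htc, a, ha, b, hb, hab⟩ := h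
  exact ⟨a, b, hab, htc.subset_connectedComponent ha hb, hball (ht ha), hball (ht hb)⟩

/-- A continuous function can be changed by at most `η` so as to take prescribed values,
`η`-close to the original ones, at finitely many distinct points. -/
theorem exists_dist_le_forall_apply_eq {K ι : Type*} [MetricSpace K] [CompactSpace K] [Finite ι]
    {e : ι → K} (he : Function.Injective e) (f : C(K, ℝ)) (v : ι → ℝ) {η : ℝ} (hη : 0 ≤ η)
    (hv : ∀ i, |v i - f (e i)| ≤ η) :
    ∃ g : C(K, ℝ), dist g f ≤ η ∧ ∀ i, g (e i) = v i := by
  let _ : TopologicalSpace ι := ⊥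
  have : DiscreteTopology ι := ⟨rfl⟩
  have hcl : IsClosedEmbedding e := continuous_of_discreteTopology.isClosedEmbedding he
  obtain ⟨h, hh, hhe⟩ := ContinuousMap.exists_extension_forall_mem_of_isClosedEmbedding
    (⟨fun i => v i - f (e i), continuous_of_discreteTopology⟩ : C(ι, ℝ)) (t := Icc (-η) η)
    (fun i => abs_le.1 (hv i)) ⟨0, by simp [hη]⟩ hcl
  refine ⟨f + h, ?_, fun i => ?_⟩
  · rw [ContinuousMap.dist_le hη]
    intro x
    simpa [Real.dist_eq] using abs_le.2 (hh x)
  · have : h (e i) = v i - f (e i) := congr_fun hhe i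
    simp [this]

theorem dense_compl_uncrossedLevelSet {K : Type*} [MetricSpace K] [CompactSpace K]
    (hK : ∀ (x : K) (r : ℝ), 0 < r → ¬ IsTotallyDisconnected (closedBall x r))
    {p q : ℝ} (hpq : p < q) : Dense (uncrossedLevelSet K p q)ᶜ := by
  intro f
  by_cases hf : f ∈ uncrossedLevelSet K p q
  swap
  · exact subset_closure hf
  rw [Metric.mem_closure_iff]
  intro ε hε
  obtain ⟨n, hn⟩ := exists_nat_gt (2 * (q - p) / ε)
  have hn0 : (0 : ℝ) < n := lt_trans (by have := sub_pos.2 hpq; positivity) hn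
  obtain ⟨d, hd⟩ : ∃ d, d = (q - p) / n := ⟨_, rfl⟩
  have hd0 : 0 < d := hd ▸ div_pos (sub_pos.2 hpq) hn0
  have hnd : n * d = q - p := by rw [hd]; field_simp
  have hdε : 2 * d < ε := by
    rw [div_lt_iff₀ hε] at hn
    nlinarith
  have hx : ∀ i : Fin (n + 1), ∃ x, f x = p + i * d := by
    intro i
    have hi : (i : ℝ) ≤ n := by exact_mod_cast Nat.le_of_lt_succ i.2
    exact hf.1 ⟨by have : (0 : ℝ) ≤ i * d := by positivity
                   linarith, by nlinarith⟩
  choose x hx using hx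
  choose a b hab hconn ha hb using fun i =>
    exists_ne_mem_connectedComponent_abs_sub_lt hK f (x i) (half_pos hd0)
  simp only [hx] at ha hb
  have hsep : ∀ i j : Fin (n + 1), ∀ s : ℝ, |s - (p + i * d)| < d / 2 →
      |s - (p + j * d)| < d / 2 → i = j := by
    intro i j s hi hj
    rw [abs_lt] at hi hj
    have h1 : (i : ℝ) < j + 1 := by by_contra! h; nlinarith
    have h2 : (j : ℝ) < i + 1 := by by_contra! h; nlinarith
    norm_cast at h1 h2
    omega
  have hinj : Function.Injective (Sum.elim a b) := by
    refine Function.Injective.sumElim (fun i j hij => hsep i j _ (ha i) (hij ▸ ha j))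
      (fun i j hij => hsep i j _ (hb i) (hij ▸ hb j)) fun i j hij => ?_
    obtain rfl := hsep i j _ (ha i) (hij ▸ hb j)
    exact hab i hij
  obtain ⟨g, hgf, hg⟩ := exists_dist_le_forall_apply_eq hinj f
    (Sum.elim (fun i => p + i * d - d) (fun i => p + i * d + d)) (η := 2 * d) (by positivity) (by
      rintro (i | i)
      · have := abs_lt.1 (ha i)
        simp only [Sum.elim_inl, abs_le]
        constructor <;> linarith
      · have := abs_lt.1 (hb i)
        simp only [Sum.elim_inr, abs_le]
        constructor <;> linarith)
  refine ⟨g, ?_, by rw [dist_comm]; exact hgf.trans_lt hdε⟩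
  rintro ⟨-, ⟨y, hy⟩, hcross⟩
  have hyd : 0 ≤ (y - p) / d := div_nonneg (sub_nonneg.2 hy.1) hd0.le
  have hle : ⌊(y - p) / d⌋₊ * d ≤ y - p := (le_div_iff₀ hd0).1 (Nat.floor_le hyd)
  have hlt : y - p < (⌊(y - p) / d⌋₊ + 1) * d := (div_lt_iff₀ hd0).1 (Nat.lt_floor_add_one _)
  have hfl : ⌊(y - p) / d⌋₊ < n + 1 := by
    have : (⌊(y - p) / d⌋₊ : ℝ) < n + 1 := by
      by_contra! h
      nlinarith [hy.2]
    exact_mod_cast this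
  have hga := hg (Sum.inl ⟨_, hfl⟩)
  have hgb := hg (Sum.inr ⟨_, hfl⟩)
  simp only [Sum.elim_inl, Sum.elim_inr] at hga hgb
  rcases hcross _ _ (hconn ⟨_, hfl⟩) with h | h
  · simp only [hga] at h
    linarith
  · simp only [hgb] at h
    linarith

/-- Let `K` be a compact metric space such that no closed ball of positive
radius is totally disconnected. Then for the generic `f ∈ C(K)` the union over all connected
components `C` of `K` of the interiors `int f(C)` equals `int f(K)`. -/
theorem generic_union_interior_image_components
    {K : Type*} [MetricSpace K] [CompactSpace K]
    (hK : ∀ (x : K) (r : ℝ), 0 < r → ¬ IsTotallyDisconnected (closedBall x r)) :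
    {f : C(K, ℝ) | (⋃ x : K, interior (f '' connectedComponent x)) = interior (range f)} ∈
      residual C(K, ℝ) := by
  have hres : ∀ᶠ f in residual C(K, ℝ), ∀ p q : ℚ, (p : ℝ) < q →
      f ∉ uncrossedLevelSet K p q := by
    rw [eventually_countable_forall]
    intro p
    rw [eventually_countable_forall]
    intro q
    by_cases hpq : (p : ℝ) < q
    · filter_upwards [residual_of_dense_open (isClosed_uncrossedLevelSet K p q).isOpen_compl
        (dense_compl_uncrossedLevelSet hK hpq)] with f hf _ using hf
    · exact Filter.Eventually.of_forall fun f h => absurd h hpq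
  filter_upwards [hres] with f hf
  refine Subset.antisymm (iUnion_subset fun x => interior_mono (image_subset_range _ _)) ?_
  intro y hy
  obtain ⟨l, u, ⟨hly, hyu⟩, hlu⟩ :=
    mem_nhds_iff_exists_Ioo_subset.1 (mem_interior_iff_mem_nhds.1 hy)
  obtain ⟨p, hlp, hpy⟩ := exists_rat_btwn hly
  obtain ⟨q, hyq, hqu⟩ := exists_rat_btwn hyu
  have hcross := hf p q (hpy.trans hyq)
  simp only [uncrossedLevelSet, mem_ofPred_eq, not_and, not_exists, not_forall, not_or,
    not_le] at hcross
  obtain ⟨a, b, hab, hay, hyb⟩ :=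
    hcross ((Icc_subset_Ioo hlp hqu).trans hlu) ⟨y, hpy.le, hyq.le⟩
  refine mem_iUnion.2 ⟨a, mem_interior_iff_mem_nhds.2 ?_⟩
  exact Filter.mem_of_superset (Icc_mem_nhds hay hyb)
    ((isPreconnected_connectedComponent.image f f.continuous.continuousOn).Icc_subset
      (mem_image_of_mem f mem_connectedComponent) (mem_image_of_mem f hab))
end

section
/- Let K be a compact metric space with a fixed point x₀ ∈ K, and let K_n ⊆ K (n ∈ ℕ) be compact sets such that (i) each K_n is not totally disconnected (equivalently, has positive topological dimension), and (ii) diam(K_n ∪ {x₀}) → 0 as n → ∞. Then for the generic f ∈ C(K) one has f(x₀) ∈ f(K_n) for infinitely many n ∈ ℕ. -/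
open MeasureTheory Topology Metric Set

/-- In a metric space, three distinct points `c`, `a`, `b` admit a continuous function with values
in `[-1, 1]` equal to `0`, `-1`, `1` at these points respectively. -/
lemma exists_continuousMap_zero_neg_one_one {K : Type*} [MetricSpace K] {c a b : K}
    (hac : a ≠ c) (hbc : b ≠ c) (hab : a ≠ b) :
    ∃ φ : C(K, ℝ), φ c = 0 ∧ φ a = -1 ∧ φ b = 1 ∧ ∀ x, |φ x| ≤ 1 := by
  obtain ⟨r, hr, hrc, hrb, hra⟩ : ∃ r > 0, r ≤ dist c a ∧ r ≤ dist c b ∧ r ≤ dist a b :=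
    ⟨min (dist c a) (min (dist c b) (dist a b)),
      lt_min (dist_pos.2 hac.symm) (lt_min (dist_pos.2 hbc.symm) (dist_pos.2 hab)),
      min_le_left _ _, (min_le_right _ _).trans (min_le_left _ _),
      (min_le_right _ _).trans (min_le_right _ _)⟩
  have far : ∀ {d : ℝ}, r ≤ d → max 0 (1 - d / r) = 0 := fun h =>
    max_eq_left (sub_nonpos.2 ((one_le_div hr).2 h))
  have le_one : ∀ {d : ℝ}, 0 ≤ d → max 0 (1 - d / r) ≤ 1 := fun h =>
    max_le zero_le_one (sub_le_self _ (div_nonneg h hr.le))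
  refine ⟨⟨fun x => max 0 (1 - dist x b / r) - max 0 (1 - dist x a / r), by fun_prop⟩,
    ?_, ?_, ?_, fun x => ?_⟩
  · simp [far hrc, far hrb]
  · simp [far hra]
  · simp [far (hra.trans_eq (dist_comm a b))]
  · have ha := le_one (dist_nonneg (x := x) (y := a))
    have hb := le_one (dist_nonneg (x := x) (y := b))
    have ha' := le_max_left 0 (1 - dist x a / r)
    have hb' := le_max_left 0 (1 - dist x b / r)
    simp only [ContinuousMap.coe_mk, abs_le]
    constructor <;> linarith

/-- If `S` is an infinite set and `f` is `δ`-close to `f x₀` on `S`, then some `2δ`-perturbation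
of `f` takes on `S` both a value less than and a value greater than its value at `x₀`. -/
lemma exists_dist_le_lt_lt_of_infinite {K : Type*} [MetricSpace K] [CompactSpace K]
    (f : C(K, ℝ)) (x₀ : K) {S : Set K} (hS : S.Infinite) {δ : ℝ} (hδ : 0 < δ)
    (hf : ∀ x ∈ S, dist (f x) (f x₀) < δ) :
    ∃ g : C(K, ℝ), dist f g ≤ 2 * δ ∧ ∃ a ∈ S, ∃ b ∈ S, g a < g x₀ ∧ g x₀ < g b := by
  obtain ⟨a, ⟨haS, hax⟩, b, ⟨hbS, hbx⟩, hab⟩ :=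
    (hS.sdiff (Set.finite_singleton x₀)).nontrivial
  obtain ⟨φ, hφ₀, hφa, hφb, hφ⟩ := exists_continuousMap_zero_neg_one_one hax hbx hab
  have hfa := abs_lt.1 (Real.dist_eq _ _ ▸ hf a haS)
  have hfb := abs_lt.1 (Real.dist_eq _ _ ▸ hf b hbS)
  refine ⟨f + (2 * δ) • φ, ?_, a, haS, b, hbS, ?_, ?_⟩
  · refine (ContinuousMap.dist_le (by positivity)).2 fun x => ?_
    rw [dist_comm, Real.dist_eq]
    simp only [ContinuousMap.add_apply, ContinuousMap.smul_apply, smul_eq_mul,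
      add_sub_cancel_left, abs_mul, abs_of_pos (show 0 < 2 * δ by positivity)]
    exact mul_le_of_le_one_right (by positivity) (hφ x)
  · simp only [ContinuousMap.add_apply, ContinuousMap.smul_apply, smul_eq_mul, hφ₀, hφa]
    linarith
  · simp only [ContinuousMap.add_apply, ContinuousMap.smul_apply, smul_eq_mul, hφ₀, hφb]
    linarith

/-- Let `K` be a compact metric space, `x₀ ∈ K`, and let `Kₙ ⊆ K` (`n ∈ ℕ`) be
compact sets such that each `Kₙ` is not totally disconnected and `diam (Kₙ ∪ {x₀}) → 0`. Then
for the generic `f ∈ C(K)` we have `f(x₀) ∈ f(Kₙ)` for infinitely many `n`. -/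
theorem generic_value_in_image_frequently
    {K : Type*} [MetricSpace K] [CompactSpace K] (x₀ : K) (Kn : ℕ → Set K)
    (hcpt : ∀ n, IsCompact (Kn n))
    (htd : ∀ n, ¬ IsTotallyDisconnected (Kn n))
    (hdiam : Filter.Tendsto (fun n => Metric.diam (Kn n ∪ {x₀})) Filter.atTop (nhds 0)) :
    {f : C(K, ℝ) | ∃ᶠ n in Filter.atTop, f x₀ ∈ f '' Kn n} ∈ residual C(K, ℝ) := by
  have hfreq : ∀ N, {f : C(K, ℝ) | ∃ n ≥ N, f x₀ ∈ f '' Kn n} ∈ residual C(K, ℝ) := by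
    intro N
    let U : Set C(K, ℝ) := {f | ∃ n ≥ N, ∃ S ⊆ Kn n, IsPreconnected S ∧
      ∃ a ∈ S, ∃ b ∈ S, f a < f x₀ ∧ f x₀ < f b}
    have hopen : IsOpen U := by
      refine isOpen_iff_mem_nhds.2 ?_
      rintro f ⟨n, hn, S, hSK, hS, a, ha, b, hb, hfa, hfb⟩
      have hlt : ∀ x y : K, IsOpen {g : C(K, ℝ) | g x < g y} := fun x y =>
        isOpen_lt (continuous_eval_const x) (continuous_eval_const y)
      filter_upwards [(hlt a x₀).mem_nhds hfa, (hlt x₀ b).mem_nhds hfb] with g hga hgb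
      exact ⟨n, hn, S, hSK, hS, a, ha, b, hb, hga, hgb⟩
    have hdense : Dense U := by
      refine Metric.dense_iff.2 fun f ε hε => ?_
      obtain ⟨η, hη, hfη⟩ := Metric.continuousAt_iff.1 f.continuous.continuousAt (ε / 3)
        (by positivity : ε / 3 > 0)
      obtain ⟨n, hnη, hnN⟩ :=
        ((hdiam.eventually_lt_const hη).and (Filter.eventually_ge_atTop N)).exists
      obtain ⟨S, hSK, hS, hSn⟩ : ∃ S ⊆ Kn n, IsPreconnected S ∧ S.Nontrivial := by
        simpa [IsTotallyDisconnected, Set.not_subsingleton_iff] using htd n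
      obtain ⟨g, hg, hgS⟩ := exists_dist_le_lt_lt_of_infinite f x₀
        (hS.infinite_of_nontrivial hSn) (by positivity : 0 < ε / 3) fun x hx =>
          hfη ((Metric.dist_le_diam_of_mem Metric.isBounded_of_compactSpace
            (mem_union_left _ (hSK hx)) (mem_union_right _ (mem_singleton x₀))).trans_lt hnη)
      refine ⟨g, ?_, n, hnN, S, hSK, hS, hgS⟩
      rw [Metric.mem_ball, dist_comm]
      linarith
    filter_upwards [residual_of_dense_open hopen hdense]
    rintro f ⟨n, hn, S, hSK, hS, a, ha, b, hb, hfa, hfb⟩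
    exact ⟨n, hn, Set.image_mono hSK
      (hS.intermediate_value ha hb f.continuous.continuousOn ⟨hfa.le, hfb.le⟩)⟩
  filter_upwards [countable_iInter_mem.2 hfreq] with f hf
  exact Filter.frequently_atTop.2 (Set.mem_iInter.1 hf)
end

section
/- The Smith–Volterra–Cantor set S is an attractor of an iterated function system: there exist two contractions φ₁, φ₂ : S → S (Lipschitz maps with Lipschitz constant at most 1/2) such that S = φ₁(S) ∪ φ₂(S). -/
open MeasureTheory Topology Metric Set

/-- The common length of the `2^n` closed intervals of the `n`-th step of the construction of the
Smith–Volterra–Cantor set: in the `n`-th step the middle open interval of length `1/2^(2n)` is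
removed from each interval of the previous step, so the intervals of level `n` have length
`1/2^(n+1) + 1/2^(2n+1)` (in particular level `0` is the single interval `[0,1]`). -/
noncomputable def svcLen (n : ℕ) : ℝ := 1 / 2 ^ (n + 1) + 1 / 2 ^ (2 * n + 1)

/-- `svcLeft n σ` is the position, relative to the left endpoint of a level-`n` interval of the
Smith–Volterra–Cantor construction, of the left endpoint of the subinterval selected by the
path `σ` (`false` = left child, `true` = right child).  The right child of a level-`n` interval
starts at distance `svcLen (n+1) + 1/2^(2(n+1))` from the left endpoint, i.e. the removed middle
open interval has length `1/2^(2(n+1))` and is concentric. -/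
noncomputable def svcLeft : ℕ → List Bool → ℝ
  | _, [] => 0
  | n, false :: σ => svcLeft (n + 1) σ
  | n, true :: σ => svcLen (n + 1) + 1 / 2 ^ (2 * (n + 1)) + svcLeft (n + 1) σ

/-- The Smith–Volterra–Cantor set `S ⊆ [0,1]`: the intersection over `n` of the unions of the
`2^n` closed level-`n` intervals of the construction. -/
noncomputable def SVC : Set ℝ :=
  ⋂ n : ℕ, ⋃ σ ∈ {σ : List Bool | σ.length = n},
    Set.Icc (svcLeft 0 σ) (svcLeft 0 σ + svcLen n)

/-- A nonnegative real sequence each of whose terms is at most half of the preceding one. -/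
structure IsHalving (L : ℕ → ℝ) : Prop where
  nonneg : ∀ k, 0 ≤ L k
  two_mul_succ_le : ∀ k, 2 * L (k + 1) ≤ L k

/-- The sum of the decrements `L k - L (k + 1)` over the indices `k` with `ε k = true`. -/
noncomputable def gapSum (L : ℕ → ℝ) (ε : ℕ → Bool) : ℝ :=
  ∑' k, if ε k then L k - L (k + 1) else 0

/-- The binary sequence `b, ε 0, ε 1, …`. -/
def consSeq (b : Bool) (ε : ℕ → Bool) : ℕ → Bool
  | 0 => b
  | k + 1 => ε k

theorem consSeq_zero_tail (ε : ℕ → Bool) : consSeq (ε 0) (fun k => ε (k + 1)) = ε := by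
  funext k
  cases k <;> rfl

namespace IsHalving

variable {L : ℕ → ℝ}

theorem shift (h : IsHalving L) (n : ℕ) : IsHalving fun k => L (n + k) :=
  ⟨fun _ => h.nonneg _, fun k => h.two_mul_succ_le (n + k)⟩

theorem gap_nonneg (h : IsHalving L) (k : ℕ) : 0 ≤ L k - L (k + 1) := by
  linarith [h.nonneg (k + 1), h.two_mul_succ_le k]

theorem le_geometric (h : IsHalving L) (k : ℕ) : L k ≤ L 0 * (1 / 2) ^ k := by
  induction k with
  | zero => simp
  | succ k ih =>
    rw [pow_succ]
    linarith [h.two_mul_succ_le k]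

theorem tendsto_zero (h : IsHalving L) : Filter.Tendsto L Filter.atTop (𝓝 0) := by
  refine squeeze_zero h.nonneg h.le_geometric ?_
  simpa using (tendsto_pow_atTop_nhds_zero_of_lt_one (r := (1 / 2 : ℝ)) (by norm_num)
    (by norm_num)).const_mul (L 0)

theorem hasSum_gap (h : IsHalving L) : HasSum (fun k => L k - L (k + 1)) (L 0) := by
  rw [hasSum_iff_tendsto_nat_of_nonneg h.gap_nonneg]
  simp only [Finset.sum_range_sub']
  simpa using h.tendsto_zero.const_sub (L 0)

theorem ite_gap_nonneg (h : IsHalving L) (ε : ℕ → Bool) (k : ℕ) :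
    0 ≤ if ε k then L k - L (k + 1) else 0 := by
  split_ifs
  exacts [h.gap_nonneg k, le_rfl]

theorem ite_gap_le (h : IsHalving L) (ε : ℕ → Bool) (k : ℕ) :
    (if ε k then L k - L (k + 1) else 0) ≤ L k - L (k + 1) := by
  split_ifs
  exacts [le_rfl, h.gap_nonneg k]

theorem summable_ite_gap (h : IsHalving L) (ε : ℕ → Bool) :
    Summable fun k => if ε k then L k - L (k + 1) else 0 :=
  .of_nonneg_of_le (h.ite_gap_nonneg ε) (h.ite_gap_le ε) h.hasSum_gap.summable

theorem gapSum_nonneg (h : IsHalving L) (ε : ℕ → Bool) : 0 ≤ gapSum L ε :=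
  tsum_nonneg (h.ite_gap_nonneg ε)

theorem gapSum_le (h : IsHalving L) (ε : ℕ → Bool) : gapSum L ε ≤ L 0 := by
  rw [← h.hasSum_gap.tsum_eq]
  exact (h.summable_ite_gap ε).tsum_le_tsum (h.ite_gap_le ε) h.hasSum_gap.summable

theorem gapSum_consSeq (h : IsHalving L) (b : Bool) (ε : ℕ → Bool) :
    gapSum L (consSeq b ε) =
      (if b then L 0 - L 1 else 0) + gapSum (fun k => L (k + 1)) ε :=
  (h.summable_ite_gap _).tsum_eq_zero_add

theorem continuous_gapSum (h : IsHalving L) : Continuous (gapSum L) := by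
  refine continuous_tsum (fun k => ?_) h.hasSum_gap.summable (fun k ε => ?_)
  · exact (continuous_of_discreteTopology
      (f := fun b : Bool => if b then L k - L (k + 1) else 0)).comp (continuous_apply k)
  · rw [Real.norm_of_nonneg (h.ite_gap_nonneg ε k)]
    exact h.ite_gap_le ε k

/-- `gapSum` is monotone for the lexicographic order on binary sequences. -/
theorem gapSum_le_gapSum (h : IsHalving L) {ε ε' : ℕ → Bool} {m : ℕ}
    (heq : ∀ k < m, ε k = ε' k) (hm : ε m = false) (hm' : ε' m = true) :
    gapSum L ε ≤ gapSum L ε' := by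
  have hL : IsHalving fun k => L (k + 1) :=
    ⟨fun k => h.nonneg _, fun k => h.two_mul_succ_le (k + 1)⟩
  induction m generalizing L ε ε' with
  | zero =>
    rw [← consSeq_zero_tail ε, ← consSeq_zero_tail ε', h.gapSum_consSeq, h.gapSum_consSeq, hm, hm']
    have h₁ := hL.gapSum_le fun k => ε (k + 1)
    have h₂ := hL.gapSum_nonneg fun k => ε' (k + 1)
    have h₃ := h.two_mul_succ_le 0
    simp only [zero_add] at h₁ h₃
    simp only [Bool.false_eq_true, if_false, if_true]
    linarith
  | succ m ih =>
    rw [← consSeq_zero_tail ε, ← consSeq_zero_tail ε', h.gapSum_consSeq, h.gapSum_consSeq,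
      heq 0 m.succ_pos]
    gcongr
    exact ih hL (fun k hk => heq (k + 1) (by omega)) hm hm'
      ⟨fun k => h.nonneg _, fun k => h.two_mul_succ_le (k + 2)⟩

end IsHalving

theorem svcLen_eq_two_mul_add (n : ℕ) :
    svcLen n = 2 * svcLen (n + 1) + 1 / 2 ^ (2 * (n + 1)) := by
  simp only [svcLen, mul_add, pow_add, mul_one, pow_one]
  field_simp
  ring

theorem isHalving_svcLen : IsHalving svcLen where
  nonneg k := by unfold svcLen; positivity
  two_mul_succ_le k := by
    rw [svcLen_eq_two_mul_add k]
    linarith [show (0 : ℝ) ≤ 1 / 2 ^ (2 * (k + 1)) by positivity]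

theorem svcLeft_cons (n : ℕ) (b : Bool) (σ : List Bool) :
    svcLeft n (b :: σ) = (if b then svcLen n - svcLen (n + 1) else 0) + svcLeft (n + 1) σ := by
  cases b
  · simp [svcLeft]
  · simp only [svcLeft, if_true]
    linarith [svcLen_eq_two_mul_add n]

theorem gapSum_svcLen_consSeq (n : ℕ) (b : Bool) (ε : ℕ → Bool) :
    gapSum (fun k => svcLen (n + k)) (consSeq b ε) =
      (if b then svcLen n - svcLen (n + 1) else 0) + gapSum (fun k => svcLen (n + 1 + k)) ε := by
  rw [(isHalving_svcLen.shift n).gapSum_consSeq]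
  simp only [add_zero, add_assoc, add_comm 1]

theorem exists_svcLeft_eq_gapSum (n : ℕ) (σ : List Bool) :
    ∃ ε, svcLeft n σ = gapSum (fun k => svcLen (n + k)) ε := by
  induction σ generalizing n with
  | nil => exact ⟨fun _ => false, by simp [svcLeft, gapSum]⟩
  | cons b σ ih =>
    obtain ⟨ε, hε⟩ := ih (n + 1)
    exact ⟨consSeq b ε, by rw [svcLeft_cons, gapSum_svcLen_consSeq, hε]⟩

theorem exists_gapSum_mem_Icc_svcLeft (m n : ℕ) (ε : ℕ → Bool) :
    ∃ σ : List Bool, σ.length = m ∧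
      gapSum (fun k => svcLen (n + k)) ε ∈ Icc (svcLeft n σ) (svcLeft n σ + svcLen (n + m)) := by
  induction m generalizing n ε with
  | zero =>
    have h := isHalving_svcLen.shift n
    exact ⟨[], rfl, by simpa [svcLeft] using ⟨h.gapSum_nonneg ε, h.gapSum_le ε⟩⟩
  | succ m ih =>
    obtain ⟨σ, hσ, h₁, h₂⟩ := ih (n + 1) fun k => ε (k + 1)
    refine ⟨ε 0 :: σ, by simp [hσ], ?_⟩
    have hcons := gapSum_svcLen_consSeq n (ε 0) fun k => ε (k + 1)
    rw [consSeq_zero_tail] at hcons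
    rw [hcons, svcLeft_cons]
    rw [add_assoc n 1 m, add_comm 1 m] at h₂
    constructor <;> linarith

theorem SVC_eq_range_gapSum : SVC = range (gapSum svcLen) := by
  have hshift : (fun k => svcLen (0 + k)) = svcLen := by simp
  apply Subset.antisymm
  · intro x hx
    have hclosed : IsClosed (range (gapSum svcLen)) :=
      (isCompact_range isHalving_svcLen.continuous_gapSum).isClosed
    rw [← hclosed.closure_eq, Metric.mem_closure_iff]
    intro δ hδ
    obtain ⟨n, hn⟩ := (isHalving_svcLen.tendsto_zero.eventually_lt_const hδ).exists
    simp only [SVC, mem_iInter, mem_iUnion, mem_ofPred_eq] at hx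
    obtain ⟨σ, -, h₁, h₂⟩ := hx n
    obtain ⟨ε, hε⟩ := exists_svcLeft_eq_gapSum 0 σ
    rw [hshift] at hε
    refine ⟨_, ⟨ε, rfl⟩, ?_⟩
    rw [← hε, Real.dist_eq, abs_of_nonneg (by linarith)]
    linarith
  · rintro _ ⟨ε, rfl⟩
    simp only [SVC, mem_iInter, mem_iUnion, mem_ofPred_eq]
    intro n
    obtain ⟨σ, hσ, h⟩ := exists_gapSum_mem_Icc_svcLeft n 0 ε
    rw [hshift, zero_add] at h
    exact ⟨σ, hσ, h⟩

theorem isHalving_half_svcLen_sub :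
    IsHalving fun k => 1 / 2 * svcLen k - svcLen (k + 1) := by
  have h (k : ℕ) : 1 / 2 * svcLen k - svcLen (k + 1) = 1 / 8 * (1 / 4) ^ k := by
    rw [svcLen_eq_two_mul_add k, pow_mul, pow_succ, one_div_pow]
    norm_num
    ring
  simp only [h]
  refine ⟨fun k => by positivity, fun k => ?_⟩
  rw [pow_succ]
  linarith [show (0 : ℝ) ≤ (1 / 4) ^ k by positivity]

theorem isHalving_svcLen_succ : IsHalving fun k => svcLen (k + 1) :=
  ⟨fun _ => isHalving_svcLen.nonneg _, fun k => isHalving_svcLen.two_mul_succ_le (k + 1)⟩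

theorem gapSum_half_svcLen_sub (ε : ℕ → Bool) :
    gapSum (fun k => 1 / 2 * svcLen k - svcLen (k + 1)) ε =
      1 / 2 * gapSum svcLen ε - gapSum (fun k => svcLen (k + 1)) ε := by
  unfold gapSum
  rw [← tsum_mul_left, ← ((isHalving_svcLen.summable_ite_gap ε).mul_left _).tsum_sub
    (isHalving_svcLen_succ.summable_ite_gap ε)]
  congr 1
  funext k
  split_ifs <;> ring

theorem dist_gapSum_svcLen_succ_le (ε ε' : ℕ → Bool) :
    dist (gapSum (fun k => svcLen (k + 1)) ε) (gapSum (fun k => svcLen (k + 1)) ε') ≤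
      1 / 2 * dist (gapSum svcLen ε) (gapSum svcLen ε') := by
  by_cases hne : ∃ k, ε k ≠ ε' k
  · classical
    have heq (k : ℕ) (hk : k < Nat.find hne) : ε k = ε' k := not_not.1 (Nat.find_min hne hk)
    have hm := Nat.find_spec hne
    generalize Nat.find hne = m at heq hm
    clear hne
    wlog hε : ε m = false generalizing ε ε'
    · rw [dist_comm, dist_comm (gapSum svcLen ε)]
      refine this ε' ε (fun k hk => (heq k hk).symm) hm.symm ?_
      cases h : ε' m <;> simp_all
    have hε' : ε' m = true := by
      cases h : ε' m <;> simp_all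
    have h₁ := isHalving_svcLen.gapSum_le_gapSum heq hε hε'
    have h₂ := isHalving_svcLen_succ.gapSum_le_gapSum heq hε hε'
    have h₃ := isHalving_half_svcLen_sub.gapSum_le_gapSum heq hε hε'
    rw [gapSum_half_svcLen_sub, gapSum_half_svcLen_sub] at h₃
    rw [Real.dist_eq, Real.dist_eq, abs_of_nonpos (by linarith), abs_of_nonpos (by linarith)]
    linarith
  · push Not at hne
    simp [funext hne]

/-- For either binary digit `b`, prepending `b` to binary codes is a well-defined contraction. -/
theorem exists_lipschitzWith_consSeq (b : Bool) :
    ∃ φ : SVC → SVC, LipschitzWith (1 / 2) φ ∧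
      ∀ ε, ∃ x, (φ x : ℝ) = gapSum svcLen (consSeq b ε) := by
  have hcode (x : SVC) : ∃ ε, gapSum svcLen ε = x :=
    SVC_eq_range_gapSum.subset x.2
  choose code hcode using hcode
  have hmem (ε : ℕ → Bool) : gapSum svcLen ε ∈ SVC := SVC_eq_range_gapSum ▸ mem_range_self ε
  refine ⟨fun x => ⟨gapSum svcLen (consSeq b (code x)), hmem _⟩, ?_, fun ε => ?_⟩
  · refine LipschitzWith.of_dist_le_mul fun x y => ?_
    have h := dist_gapSum_svcLen_succ_le (code x) (code y)
    rw [hcode, hcode] at h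
    simpa only [NNReal.coe_div, NNReal.coe_one, NNReal.coe_ofNat, Subtype.dist_eq,
      isHalving_svcLen.gapSum_consSeq, dist_add_left] using h
  · refine ⟨⟨gapSum svcLen ε, hmem ε⟩, ?_⟩
    have h := dist_gapSum_svcLen_succ_le (code ⟨gapSum svcLen ε, hmem ε⟩) ε
    rw [hcode, dist_self, mul_zero] at h
    simp only [isHalving_svcLen.gapSum_consSeq, dist_le_zero.1 h]

/-- The Smith–Volterra–Cantor set is an attractor of an iterated function
system: there are two contractions `φ₁, φ₂ : S → S` (Lipschitz, with Lipschitz constant at most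
`1/2`) such that `S = φ₁(S) ∪ φ₂(S)`. -/
theorem svc_isAttractor :
    ∃ φ₁ φ₂ : SVC → SVC, LipschitzWith (1 / 2) φ₁ ∧ LipschitzWith (1 / 2) φ₂ ∧
      Set.range φ₁ ∪ Set.range φ₂ = Set.univ := by
  obtain ⟨φ₁, hφ₁, hsurj₁⟩ := exists_lipschitzWith_consSeq false
  obtain ⟨φ₂, hφ₂, hsurj₂⟩ := exists_lipschitzWith_consSeq true
  refine ⟨φ₁, φ₂, hφ₁, hφ₂, eq_univ_of_forall fun ⟨y, hy⟩ => ?_⟩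
  obtain ⟨ε, rfl⟩ := SVC_eq_range_gapSum ▸ hy
  cases h : ε 0
  · obtain ⟨x, hx⟩ := hsurj₁ fun k => ε (k + 1)
    exact .inl ⟨x, Subtype.ext (by rw [hx, ← h, consSeq_zero_tail])⟩
  · obtain ⟨x, hx⟩ := hsurj₂ fun k => ε (k + 1)
    exact .inr ⟨x, Subtype.ext (by rw [hx, ← h, consSeq_zero_tail])⟩
end

section
/- Let K be a compact metric space that is not totally disconnected (equivalently, has positive topological dimension). Then for the generic f ∈ C(K) the supremum of the Hausdorff dimensions of the level sets of f is attained and equals dim_tH K − 1: there exists y ∈ ℝ with dim_H f⁻¹(y) = dim_tH K − 1, while dim_H f⁻¹(y') ≤ dim_tH K − 1 for every y' ∈ ℝ. -/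
open MeasureTheory Topology Metric Set
open scoped Classical

/-- The topological Hausdorff dimension of a metric space `X`:
`dim_tH X = inf {d : X has a basis 𝒰 such that dim_H ∂U ≤ d − 1 for every U ∈ 𝒰}`, with the
convention `dim_tH ∅ = -1` (the infimum of the empty set of extended reals being `⊤`). -/
noncomputable def tHdim (X : Type*) [MetricSpace X] : EReal :=
  if Nonempty X then
    sInf {d : EReal | ∃ 𝒰 : Set (Set X), TopologicalSpace.IsTopologicalBasis 𝒰 ∧
      ∀ U ∈ 𝒰, hdim (frontier U) ≤ d - 1}
  else -1

theorem mem_residual_of_forall_exists_ball_subset {X : Type*} [PseudoMetricSpace X] {S : Set X}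
    (h : ∀ x, ∀ ε > 0, ∃ y, dist y x < ε ∧ ∃ δ > 0, ball y δ ⊆ S) : S ∈ residual X := by
  refine Filter.mem_of_superset (residual_of_dense_open isOpen_interior ?_) interior_subset
  refine Metric.dense_iff.2 fun x ε hε => ?_
  obtain ⟨y, hy, δ, hδ, hS⟩ := h x ε hε
  exact ⟨y, hy, mem_interior.2 ⟨_, hS, isOpen_ball, mem_ball_self hδ⟩⟩

theorem exists_injective_forall_abs_sub_lt {ι : Type*} [Finite ι] (a : ι → ℝ) {ε : ℝ}
    (hε : 0 < ε) : ∃ c : ι → ℝ, Function.Injective c ∧ ∀ i, |c i - a i| < ε := by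
  obtain ⟨n, ⟨e⟩⟩ := Finite.exists_equiv_fin ι
  have h1 : ∀ᶠ t : ℝ in 𝓝[>] 0, ∀ i, |t * (e i : ℝ)| < ε := by
    refine Filter.eventually_all.2 fun i => nhdsWithin_le_nhds ?_
    have : Continuous fun t : ℝ => |t * (e i : ℝ)| := by fun_prop
    exact this.continuousAt.eventually_lt_const (by simpa using hε)
  have h2 : ∀ᶠ t : ℝ in 𝓝[>] 0, ∀ i j, i ≠ j → a i + t * (e i : ℝ) ≠ a j + t * (e j : ℝ) := by
    refine Filter.eventually_all.2 fun i => Filter.eventually_all.2 fun j => ?_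
    have h3 : ∀ᶠ t : ℝ in 𝓝[>] 0, t ≠ (a j - a i) / ((e i : ℝ) - e j) := by
      rcases eq_or_ne ((a j - a i) / ((e i : ℝ) - e j)) 0 with h0 | h0
      · rw [h0]
        filter_upwards [self_mem_nhdsWithin] with t ht using ne_of_gt ht
      · exact nhdsWithin_le_nhds (eventually_ne_nhds h0.symm)
    filter_upwards [h3] with t ht hij heq
    have hne : (e i : ℝ) - e j ≠ 0 := by
      rw [sub_ne_zero]
      exact_mod_cast fun h => hij (e.injective (Fin.ext h))
    exact ht ((eq_div_iff hne).2 (by linarith))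
  obtain ⟨t, ht1, ht2⟩ := (h1.and h2).exists
  refine ⟨fun i => a i + t * (e i : ℝ), fun i j hij => ?_, fun i => by simpa using ht1 i⟩
  by_contra hne
  exact ht2 i j hne hij

theorem exists_pos_forall_ne_le_abs_sub {ι : Type*} [Finite ι] {c : ι → ℝ}
    (hc : Function.Injective c) : ∃ η > 0, ∀ i j, i ≠ j → η ≤ |c i - c j| := by
  have h : ∀ᶠ η : ℝ in 𝓝[>] 0, ∀ i j, i ≠ j → η ≤ |c i - c j| := by
    refine Filter.eventually_all.2 fun i => Filter.eventually_all.2 fun j => ?_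
    rcases eq_or_ne i j with rfl | hij
    · simp
    · filter_upwards [nhdsWithin_le_nhds
        (eventually_le_nhds (abs_pos.2 (sub_ne_zero.2 (hc.ne hij))))] with η hη _ using hη
  obtain ⟨η, hη, hpos⟩ := (h.and self_mem_nhdsWithin).exists
  exact ⟨η, hpos, hη⟩

/-- The `s`-dimensional Hausdorff content. -/
noncomputable def hausdorffContent (X : Type*) [EMetricSpace X] (s : ℝ) (hs : 0 < s) :
    OuterMeasure X :=
  OuterMeasure.ofFunction (fun A => ediam A ^ s) (by simp [hs])

section Content

variable {X : Type*} [EMetricSpace X] {s : ℝ} (hs : 0 < s)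

theorem hausdorffContent_le_ediam_rpow (A : Set X) : hausdorffContent X s hs A ≤ ediam A ^ s :=
  OuterMeasure.ofFunction_le A

theorem exists_cover_of_hausdorffContent_lt {A : Set X} {ε : ENNReal}
    (h : hausdorffContent X s hs A < ε) :
    ∃ t : ℕ → Set X, A ⊆ ⋃ n, t n ∧ ∑' n, ediam (t n) ^ s < ε := by
  rw [hausdorffContent, OuterMeasure.ofFunction_apply] at h
  simpa only [iInf_lt_iff, exists_prop] using h

theorem hausdorffMeasure_eq_zero_of_hausdorffContent_eq_zero [MeasurableSpace X] [BorelSpace X]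
    {A : Set X} (h : hausdorffContent X s hs A = 0) : μH[s] A = 0 := by
  have hpos : ∀ n : ℕ, (0 : ENNReal) < ((n : ENNReal)⁻¹) ^ s := fun n =>
    ENNReal.rpow_pos_of_nonneg (by simp) hs.le
  choose t htA htsum using fun n : ℕ =>
    exists_cover_of_hausdorffContent_lt hs (h.trans_lt (hpos n))
  have hlim : Filter.Tendsto (fun n : ℕ => ((n : ENNReal)⁻¹) ^ s) Filter.atTop (𝓝 0) := by
    have := (ENNReal.continuous_rpow_const (y := s)).tendsto 0 |>.comp
      ENNReal.tendsto_inv_nat_nhds_zero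
    simpa [hs, Function.comp_def] using this
  refine le_antisymm ?_ zero_le
  refine (Measure.hausdorffMeasure_le_liminf_tsum (l := Filter.atTop) s A
    (fun n : ℕ => (n : ENNReal)⁻¹) ENNReal.tendsto_inv_nat_nhds_zero t (.of_forall fun n i => ?_) (.of_forall htA)).trans ?_
  · rw [← ENNReal.rpow_le_rpow_iff hs]
    exact (ENNReal.le_tsum i).trans (htsum n).le
  · rw [← hlim.liminf_eq]
    exact Filter.liminf_le_liminf (.of_forall fun n => (htsum n).le)

theorem hausdorffContent_le_hausdorffMeasure [MeasurableSpace X] [BorelSpace X] (A : Set X) :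
    hausdorffContent X s hs A ≤ μH[s] A := by
  rw [Measure.hausdorffMeasure_apply]
  refine le_iSup₂_of_le 1 one_pos (le_iInf₂ fun t ht => le_iInf fun _ => ?_)
  rw [hausdorffContent, OuterMeasure.ofFunction_apply]
  refine iInf₂_le_of_le t ht (ENNReal.tsum_le_tsum fun n => ?_)
  rcases (t n).eq_empty_or_nonempty with h | h <;> simp [h, hs]

theorem exists_isOpen_superset_ediam_rpow_lt {s : ℝ} (hs : 0 < s) {A : Set X} {c : ENNReal}
    (h : ediam A ^ s < c) : ∃ U, IsOpen U ∧ A ⊆ U ∧ ediam U ^ s < c := by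
  have hc : Continuous fun r : NNReal => (ediam A + 2 * (r : ENNReal)) ^ s := by
    have h2 : Continuous fun r : NNReal => (2 : ENNReal) * r :=
      (ENNReal.continuous_const_mul (by simp)).comp ENNReal.continuous_coe
    exact ENNReal.continuous_rpow_const.comp (continuous_const.add h2)
  have hev : ∀ᶠ r : NNReal in 𝓝[>] 0, (ediam A + 2 * (r : ENNReal)) ^ s < c :=
    nhdsWithin_le_nhds (hc.continuousAt.eventually_lt_const (by simpa using h))
  obtain ⟨r, hr, hr0⟩ := (hev.and self_mem_nhdsWithin).exists
  exact ⟨Metric.thickening r A, isOpen_thickening,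
    self_subset_thickening (by exact_mod_cast hr0) A,
    (ENNReal.rpow_le_rpow (ediam_thickening_le r) hs.le).trans_lt hr⟩

theorem exists_isOpen_superset_hausdorffContent_le {A : Set X} {ε : ENNReal} (hε : 0 < ε)
    (h : hausdorffContent X s hs A = 0) :
    ∃ U, IsOpen U ∧ A ⊆ U ∧ hausdorffContent X s hs U ≤ ε := by
  obtain ⟨t, ht, hsum⟩ := exists_cover_of_hausdorffContent_lt hs
    (h.trans_lt (ENNReal.half_pos hε.ne'))
  obtain ⟨δ, hδ, hδsum⟩ := ENNReal.exists_pos_sum_of_countable' (ENNReal.half_pos hε.ne').ne' ℕ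
  have hlt : ∀ n, ediam (t n) ^ s < ediam (t n) ^ s + δ n := fun n =>
    ENNReal.lt_add_right (((ENNReal.le_tsum n).trans_lt hsum).ne_top) (hδ n).ne'
  choose U hUo hU hUlt using fun n => exists_isOpen_superset_ediam_rpow_lt hs (hlt n)
  refine ⟨⋃ n, U n, isOpen_iUnion hUo, ht.trans (iUnion_mono hU), ?_⟩
  calc hausdorffContent X s hs (⋃ n, U n) ≤ ∑' n, hausdorffContent X s hs (U n) :=
        measure_iUnion_le _
    _ ≤ ∑' n, (ediam (t n) ^ s + δ n) := ENNReal.tsum_le_tsum fun n =>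
        (hausdorffContent_le_ediam_rpow hs _).trans (hUlt n).le
    _ = ∑' n, ediam (t n) ^ s + ∑' n, δ n := ENNReal.tsum_add
    _ ≤ ε / 2 + ε / 2 := add_le_add hsum.le hδsum.le
    _ = ε := ENNReal.add_halves ε

end Content

section Hdim

variable {X : Type*} [EMetricSpace X] {A B : Set X} {q : EReal}

theorem hdim_le_iff (hq : 0 ≤ q) : hdim A ≤ q ↔ (dimH A : EReal) ≤ q := by
  unfold hdim
  split_ifs with h
  · subst h
    simp only [dimH_empty, EReal.coe_ennreal_zero, hq, iff_true]
    exact le_trans (by norm_num) hq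
  · rfl

theorem hdim_nonneg (h : A.Nonempty) : 0 ≤ hdim A := by
  simp [hdim, h.ne_empty, EReal.coe_ennreal_nonneg]

theorem hdim_mono (h : A ⊆ B) : hdim A ≤ hdim B := by
  rcases A.eq_empty_or_nonempty with hA | hA
  · rcases B.eq_empty_or_nonempty with hB | hB
    · rw [hA, hB]
    · rw [hdim, if_pos hA]
      exact le_trans (by norm_num) (hdim_nonneg hB)
  · rw [hdim, hdim, if_neg hA.ne_empty, if_neg (hA.mono h).ne_empty]
    exact EReal.coe_ennreal_le_coe_ennreal_iff.2 (dimH_mono h)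

theorem hdim_biUnion_le {ι : Type*} {t : Set ι} (ht : t.Countable) {A : ι → Set X} (hq : 0 ≤ q)
    (h : ∀ i ∈ t, hdim (A i) ≤ q) : hdim (⋃ i ∈ t, A i) ≤ q := by
  rw [hdim_le_iff hq, dimH_bUnion ht, ← EReal.coe_toENNReal hq,
    EReal.coe_ennreal_le_coe_ennreal_iff]
  refine iSup₂_le fun i hi => ?_
  rw [← EReal.coe_ennreal_le_coe_ennreal_iff, EReal.coe_toENNReal hq]
  exact (hdim_le_iff hq).1 (h i hi)

end Hdim

section LevelSets

variable {K : Type*} [MetricSpace K]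

/-- Small-boundary neighbourhoods: `x` has arbitrarily small open neighbourhoods whose boundaries
have Hausdorff dimension at most `q`. -/
def HasSmallFrontierNhds (q : EReal) (x : K) : Prop :=
  ∀ W ∈ 𝓝 x, ∃ V, IsOpen V ∧ x ∈ V ∧ V ⊆ W ∧ hdim (frontier V) ≤ q

theorem HasSmallFrontierNhds.mono {p q : EReal} {x : K} (h : HasSmallFrontierNhds p x)
    (hpq : p ≤ q) : HasSmallFrontierNhds q x := fun W hW =>
  let ⟨V, hV, hx, hVW, hd⟩ := h W hW
  ⟨V, hV, hx, hVW, hd.trans hpq⟩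

theorem tHdim_sub_one_le_of_forall_hasSmallFrontierNhds [Nonempty K] {q : EReal}
    (h : ∀ x : K, HasSmallFrontierNhds q x) : tHdim K - 1 ≤ q := by
  refine EReal.sub_le_of_le_add ?_
  rw [tHdim, if_pos ‹_›]
  refine sInf_le ⟨{V | IsOpen V ∧ hdim (frontier V) ≤ q}, ?_, fun U hU => ?_⟩
  · refine TopologicalSpace.isTopologicalBasis_of_isOpen_of_nhds (fun U hU => hU.1)
      fun x W hx hW => ?_
    obtain ⟨V, hV, hxV, hVW, hd⟩ := h x W (hW.mem_nhds hx)
    exact ⟨V, ⟨hV, hd⟩, hxV, hVW⟩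
  · exact hU.2.trans_eq (EReal.add_sub_cancel_right (b := 1)).symm

theorem exists_isTopologicalBasis_of_tHdim_sub_one_lt [Nonempty K] {q : EReal}
    (h : tHdim K - 1 < q) : ∃ 𝒰 : Set (Set K), TopologicalSpace.IsTopologicalBasis 𝒰 ∧
      ∀ U ∈ 𝒰, hdim (frontier U) < q := by
  rw [EReal.sub_lt_iff (.inl (by decide)) (.inl (by decide)), tHdim, if_pos ‹_›, sInf_lt_iff] at h
  obtain ⟨d, ⟨𝒰, hb, hd⟩, hdq⟩ := h
  exact ⟨𝒰, hb, fun U hU => (hd U hU).trans_lt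
    ((EReal.sub_lt_iff (.inl (by decide)) (.inl (by decide))).2 hdq)⟩

theorem zero_le_tHdim_sub_one (hK : ¬ TotallyDisconnectedSpace K) : 0 ≤ tHdim K - 1 := by
  by_contra! h
  rcases isEmpty_or_nonempty K with hE | hE
  · exact hK inferInstance
  obtain ⟨𝒰, hb, hd⟩ := exists_isTopologicalBasis_of_tHdim_sub_one_lt h
  have hclopen : TopologicalSpace.IsTopologicalBasis {U : Set K | IsClopen U} := by
    refine hb.of_isOpen_of_subset (fun U hU => hU.isOpen) fun U hU => ?_
    refine isClopen_iff_frontier_eq_empty.2 ?_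
    by_contra hne
    exact absurd (hdim_nonneg (nonempty_iff_ne_empty.2 hne)) (hd U hU).not_ge
  have := totallySeparatedSpace_of_t0_of_basis_clopen hclopen
  exact hK inferInstance

variable [CompactSpace K]

theorem exists_forall_nhds_exists_not_hasSmallFrontierNhds [Nonempty K]
    (hbot : (⊥ : EReal) < tHdim K - 1) :
    ∃ x₀ : K, ∀ q < tHdim K - 1, ∀ U ∈ 𝓝 x₀, ∃ x ∈ U, ¬ HasSmallFrontierNhds q x := by
  by_contra! h
  choose q hq U hU hgood using h
  obtain ⟨t, ht⟩ := CompactSpace.elim_nhds_subcover U hU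
  refine ((Finset.sup_lt_iff hbot).2 fun x (_ : x ∈ t) => hq x).not_ge
    (tHdim_sub_one_le_of_forall_hasSmallFrontierNhds fun x => ?_)
  obtain ⟨y, hy, hxy⟩ := mem_iUnion₂.1 (ht.ge (mem_univ x))
  exact (hgood y x hxy).mono (Finset.le_sup hy)

/-- The property cannot fail at an isolated point of its failure set. -/
theorem hasSmallFrontierNhds_of_punctured_nhds {q : EReal} (hq : 0 ≤ q) {x₀ : K} {U : Set K}
    (hU : U ∈ 𝓝 x₀) (h : ∀ x ∈ U, x ≠ x₀ → HasSmallFrontierNhds q x) :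
    HasSmallFrontierNhds q x₀ := by
  intro W hW
  obtain ⟨r, hr, hrU⟩ := Metric.nhds_basis_closedBall.mem_iff.1
    (Filter.inter_mem hU (interior_mem_nhds.2 hW))
  have hV : ∀ x ∈ sphere x₀ r, ∃ V, IsOpen V ∧ x ∈ V ∧ V ⊆ W ∧ hdim (frontier V) ≤ q :=
    fun x hx => h x (hrU (sphere_subset_closedBall hx)).1 (ne_of_mem_sphere hx hr.ne') W
      (mem_interior_iff_mem_nhds.1 (hrU (sphere_subset_closedBall hx)).2)
  choose! V hVo hxV hVW hVd using hV
  obtain ⟨t, hts, ht⟩ := (isCompact_sphere x₀ r).elim_nhds_subcover V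
    fun x hx => (hVo x hx).mem_nhds (hxV x hx)
  have hO : IsOpen (ball x₀ r ∪ ⋃ x ∈ t, V x) :=
    isOpen_ball.union (isOpen_biUnion fun x hx => hVo x (hts x hx))
  refine ⟨ball x₀ r ∪ ⋃ x ∈ t, V x, hO, .inl (mem_ball_self hr),
    union_subset (fun z hz => interior_subset (hrU (ball_subset_closedBall hz)).2)
      (iUnion₂_subset fun x hx => hVW x (hts x hx)), ?_⟩
  refine (hdim_mono ?_).trans
    (hdim_biUnion_le t.countable_toSet hq fun x hx => hVd x (hts x hx))
  intro z hz
  rw [hO.frontier_eq, closure_union, t.closure_biUnion] at hz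
  obtain ⟨hz1 | hz1, hz2⟩ := hz
  · rcases (show dist z x₀ ≤ r from closure_ball_subset_closedBall hz1).lt_or_eq with hlt | heq
    · exact absurd (.inl hlt) hz2
    · exact absurd (.inr (ht heq)) hz2
  · obtain ⟨x, hx, hzx⟩ := mem_iUnion₂.1 hz1
    refine mem_iUnion₂.2 ⟨x, hx, ?_⟩
    rw [(hVo x (hts x hx)).frontier_eq]
    exact ⟨hzx, fun hzV => hz2 (.inr (mem_iUnion₂.2 ⟨x, hx, hzV⟩))⟩

/-- Generically, the level set through a point near which the failure of `HasSmallFrontierNhds q`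
accumulates has dimension at least `q`. -/
theorem eventually_residual_le_hdim_level {q : EReal} {x₀ : K}
    (h : ∀ U ∈ 𝓝 x₀, ∃ x ∈ U, x ≠ x₀ ∧ ¬ HasSmallFrontierNhds q x) :
    ∀ᶠ f : C(K, ℝ) in residual C(K, ℝ), q ≤ hdim (f ⁻¹' {f x₀}) := by
  have : Nonempty K := ⟨x₀⟩
  refine mem_residual_of_forall_exists_ball_subset fun f₀ ε hε => ?_
  have hU : {z | |f₀ z - f₀ x₀| < ε / 10} ∈ 𝓝 x₀ := by
    have hc : Continuous fun z => |f₀ z - f₀ x₀| := by fun_prop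
    exact (isOpen_lt hc continuous_const).mem_nhds (by simpa using by positivity)
  obtain ⟨x, hxU, hne, hbad⟩ := h _ (interior_mem_nhds.2 hU)
  simp only [HasSmallFrontierNhds, not_forall, not_exists, not_and, not_le] at hbad
  obtain ⟨W, hW, hbad⟩ := hbad
  obtain ⟨r, hr, hrsub⟩ := Metric.nhds_basis_closedBall.mem_iff.1 (Filter.inter_mem hW
    (Filter.inter_mem (isOpen_interior.mem_nhds hxU) (isOpen_ne.mem_nhds hne)))
  have hrW : closedBall x r ⊆ W := fun z hz => (hrsub hz).1
  have hrU : ∀ z ∈ closedBall x r, |f₀ z - f₀ x₀| < ε / 10 := fun z hz =>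
    have hzU := interior_subset (hrsub hz).2.1; hzU
  have hx₀ : x₀ ∉ closedBall x r := fun hz => (hrsub hz).2.2 rfl
  obtain ⟨φ, hφ0, hφ1, hφ⟩ := exists_continuous_zero_one_of_isClosed
    (isClosed_sphere.union isClosed_singleton : IsClosed (sphere x r ∪ {x₀}))
    (isClosed_singleton : IsClosed {x}) (disjoint_singleton_right.2 (by
      rintro (hx | hx)
      · exact ne_of_mem_sphere hx hr.ne' rfl
      · exact hne hx))
  obtain ⟨ψ, hψ0, hψ1, hψ⟩ := exists_continuous_zero_one_of_isClosed
    ((Set.toFinite {x, x₀}).isClosed) (isClosed_sphere : IsClosed (sphere x r))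
    (disjoint_left.2 (by
      rintro z (rfl | rfl) hz
      · exact ne_of_mem_sphere hz hr.ne' rfl
      · exact hx₀ (sphere_subset_closedBall hz)))
  have hφx : φ x = 1 := hφ1 rfl
  have hψx : ψ x = 0 := hψ0 (by simp)
  have hφx₀ : φ x₀ = 0 := hφ0 (by simp)
  have hψx₀ : ψ x₀ = 0 := hψ0 (by simp)
  refine ⟨f₀ + (ε / 2) • (φ - ψ), ?_, ε / 10, by positivity, fun f hf => ?_⟩
  · refine (ContinuousMap.dist_lt_iff hε).2 fun z => ?_
    have h1 := hφ z
    have h2 := hψ z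
    simp only [ContinuousMap.add_apply, ContinuousMap.smul_apply, ContinuousMap.sub_apply,
      smul_eq_mul, Real.dist_eq, add_sub_cancel_left]
    rw [abs_lt]
    constructor <;> nlinarith [h1.1, h1.2, h2.1, h2.2]
  · have hclose : ∀ z, |f z - (f₀ z + ε / 2 * (φ z - ψ z))| < ε / 10 := fun z =>
      (ContinuousMap.dist_apply_le_dist z).trans_lt hf
    have hfx₀ := abs_lt.1 (hclose x₀)
    rw [hφx₀, hψx₀] at hfx₀
    have hfx : f x₀ < f x := by
      have h1 := abs_lt.1 (hclose x)
      have h2 := abs_lt.1 (hrU x (mem_closedBall_self hr.le))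
      rw [hφx, hψx] at h1
      linarith [h1.1, hfx₀.2, h2.1]
    have hfs : ∀ z ∈ sphere x r, f z < f x₀ := fun z hz => by
      have h1 := abs_lt.1 (hclose z)
      have h2 := abs_lt.1 (hrU z (sphere_subset_closedBall hz))
      have h3 : φ z = 0 := hφ0 (.inl hz)
      have h4 : ψ z = 1 := hψ1 hz
      rw [h3, h4] at h1
      linarith [h1.2, hfx₀.1, h2.2]
    have hVo : IsOpen (ball x r ∩ {z | f x₀ < f z}) :=
      isOpen_ball.inter (isOpen_lt continuous_const f.continuous)
    refine (hbad _ hVo ⟨mem_ball_self hr, hfx⟩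
      ((inter_subset_left.trans ball_subset_closedBall).trans hrW)).le.trans (hdim_mono ?_)
    intro z hz
    rw [hVo.frontier_eq] at hz
    have hcl : z ∈ closedBall x r ∩ {z | f x₀ ≤ f z} :=
      closure_minimal (inter_subset_inter ball_subset_closedBall fun w hw => le_of_lt hw)
        (isClosed_closedBall.inter (isClosed_le continuous_const f.continuous)) hz.1
    have hzb : z ∈ ball x r := lt_of_le_of_ne hcl.1 fun he => (hfs z he).not_ge hcl.2
    exact le_antisymm (not_lt.1 fun hlt => hz.2 ⟨hzb, hlt⟩) hcl.2

/-- If `K` has a basis of sets with `s`-null boundaries, then generically all level sets have small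
`s`-content: separate the members of a fine cover by the values of `f`, outside a small set. -/
theorem eventually_residual_hausdorffContent_level_le [Nonempty K] {s : ℝ} (hs : 0 < s)
    {𝒰 : Set (Set K)}
    (hb : TopologicalSpace.IsTopologicalBasis 𝒰)
    (h𝒰 : ∀ U ∈ 𝒰, hausdorffContent K s hs (frontier U) = 0) {ε : ENNReal} (hε : 0 < ε) :
    ∀ᶠ f : C(K, ℝ) in residual C(K, ℝ), ∀ y, hausdorffContent K s hs (f ⁻¹' {y}) ≤ ε := by
  have hε2 : 0 < ε / 2 := ENNReal.half_pos hε.ne'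
  refine mem_residual_of_forall_exists_ball_subset fun f₀ e he => ?_
  have hex : ∀ x : K, ∃ U ∈ 𝒰, x ∈ U ∧ ediam U ^ s < ε / 2 ∧
      ∀ z ∈ U, |f₀ z - f₀ x| < e / 4 := by
    intro x
    obtain ⟨V, hVo, hxV, hV⟩ := exists_isOpen_superset_ediam_rpow_lt hs
      (A := {x}) (c := ε / 2) (by simpa [hs] using hε.ne')
    have hc : Continuous fun z => |f₀ z - f₀ x| := by fun_prop
    obtain ⟨U, hU, hxU, hUV⟩ := hb.exists_subset_of_mem_open
      (show x ∈ V ∩ {z | |f₀ z - f₀ x| < e / 4} from ⟨hxV rfl, by simpa using by positivity⟩)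
      (hVo.inter (isOpen_lt hc continuous_const))
    exact ⟨U, hU, hxU, (ENNReal.rpow_le_rpow
      (ediam_mono (hUV.trans inter_subset_left)) hs.le).trans_lt hV, fun z hz => (hUV hz).2⟩
  choose U hU𝒰 hxU hUd hUosc using hex
  have hUo : ∀ x, IsOpen (U x) := fun x => hb.isOpen (hU𝒰 x)
  obtain ⟨t, ht⟩ := CompactSpace.elim_nhds_subcover U fun x => (hUo x).mem_nhds (hxU x)
  obtain ⟨W, hWo, hBW, hW⟩ := exists_isOpen_superset_hausdorffContent_le hs hε2
    (A := ⋃ x ∈ t, frontier (U x))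
    ((measure_biUnion_null_iff t.countable_toSet).2 fun x _ => h𝒰 _ (hU𝒰 x))
  -- `sig z` records which members of the cover contain `z`; it is locally constant off `W`.
  let sig : K → t → Prop := fun z i => z ∈ U i
  have hsig : ∀ {z w}, sig z = sig w → ∃ x, z ∈ U x ∧ w ∈ U x := by
    intro z w hzw
    obtain ⟨x, hx, hzx⟩ := mem_iUnion₂.1 (ht.ge (mem_univ z))
    have h1 : sig z ⟨x, hx⟩ := hzx
    rw [hzw] at h1
    exact ⟨x, hzx, h1⟩
  have hloc : ∀ z ∉ W, ∀ᶠ w in 𝓝 z, sig w = sig z := by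
    intro z hz
    have : ∀ᶠ w in 𝓝 z, ∀ i : t, (w ∈ U i ↔ z ∈ U i) := by
      refine Filter.eventually_all.2 fun i => ?_
      by_cases hzi : z ∈ U i
      · filter_upwards [(hUo i).mem_nhds hzi] with w hw using iff_of_true hw hzi
      · have hcl : z ∉ closure (U i) := fun hcl => hz (hBW (mem_iUnion₂.2 ⟨i, i.2, by
          rw [(hUo i).frontier_eq]; exact ⟨hcl, hzi⟩⟩))
        filter_upwards [isClosed_closure.isOpen_compl.mem_nhds hcl] with w hw
        exact iff_of_false (fun hwU => hw (subset_closure hwU)) hzi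
    exact this.mono fun w hw => funext fun i => propext (hw i)
  let a : (t → Prop) → ℝ := fun σ => if hσ : ∃ z, sig z = σ then f₀ hσ.choose else 0
  have ha : ∀ z, |a (sig z) - f₀ z| < e / 2 := by
    intro z
    have hσ : ∃ w, sig w = sig z := ⟨z, rfl⟩
    obtain ⟨x, h1, h2⟩ := hsig hσ.choose_spec
    have h3 := abs_lt.1 (hUosc x _ h1)
    have h4 := abs_lt.1 (hUosc x _ h2)
    simp only [a, dif_pos hσ]
    rw [abs_lt]
    constructor <;> linarith [h3.1, h3.2, h4.1, h4.2]
  obtain ⟨c, hcinj, hca⟩ := exists_injective_forall_abs_sub_lt a (show 0 < e / 4 by positivity)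
  obtain ⟨η, hη, hcη⟩ := exists_pos_forall_ne_le_abs_sub hcinj
  have hcont : Continuous fun z : (Wᶜ : Set K) => c (sig z) - f₀ z := by
    refine Continuous.sub (continuous_iff_continuousAt.2 fun z => ?_)
      (f₀.continuous.comp continuous_subtype_val)
    have hev : ∀ᶠ w : (Wᶜ : Set K) in 𝓝 z, c (sig w) = c (sig z) :=
      (continuousAt_subtype_val.eventually (hloc z z.2)).mono fun w hw => congrArg c hw
    exact (continuousAt_const (y := c (sig z))).congr (hev.mono fun w hw => hw.symm)
  have : CompactSpace (Wᶜ : Set K) := isCompact_iff_compactSpace.1 hWo.isClosed_compl.isCompact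
  obtain ⟨g, hgn, hg⟩ := BoundedContinuousFunction.exists_norm_eq_domRestrict_eq_of_closed
    (BoundedContinuousFunction.mkOfCompact ⟨_, hcont⟩) hWo.isClosed_compl
  have hgnorm : ‖g‖ ≤ 3 * e / 4 := by
    rw [hgn]
    refine (BoundedContinuousFunction.norm_le (by positivity)).2 fun z => ?_
    have h1 := abs_lt.1 (ha z)
    have h2 := abs_lt.1 (hca (sig z))
    rw [BoundedContinuousFunction.mkOfCompact_apply, ContinuousMap.coe_mk, Real.norm_eq_abs,
      abs_le]
    constructor <;> linarith [h1.1, h1.2, h2.1, h2.2]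
  have hgW : ∀ z ∉ W, f₀ z + g z = c (sig z) := by
    intro z hz
    have : g z = c (sig z) - f₀ z := DFunLike.congr_fun hg (⟨z, hz⟩ : (Wᶜ : Set K))
    rw [this]
    ring
  refine ⟨f₀ + g.toContinuousMap, ?_, η / 2, by positivity, fun f hf y => ?_⟩
  · refine (ContinuousMap.dist_lt_iff he).2 fun z => ?_
    have h1 := g.norm_coe_le_norm z
    rw [Real.norm_eq_abs] at h1
    simp only [ContinuousMap.add_apply, Real.dist_eq, add_sub_cancel_left]
    exact (h1.trans hgnorm).trans_lt (by linarith)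
  · have hclose : ∀ z ∉ W, |f z - c (sig z)| < η / 2 := fun z hz => by
      rw [← hgW z hz]
      exact (ContinuousMap.dist_apply_le_dist z).trans_lt hf
    obtain ⟨x, hx⟩ : ∃ x, f ⁻¹' {y} ⊆ W ∪ U x := by
      by_cases hne : ∃ z, z ∉ W ∧ f z = y
      · obtain ⟨z, hz, hzy⟩ := hne
        obtain ⟨x, hxt, hzx⟩ := mem_iUnion₂.1 (ht.ge (mem_univ z))
        refine ⟨x, fun w hw => or_iff_not_imp_left.2 fun hwW => ?_⟩
        have hwy : f w = y := hw
        have heq : sig w = sig z := by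
          by_contra hsne
          have h1 := abs_lt.1 (hclose z hz)
          have h2 := abs_lt.1 (hclose w hwW)
          refine (hcη _ _ hsne).not_gt (abs_lt.2 ⟨?_, ?_⟩) <;>
            linarith [h1.1, h1.2, h2.1, h2.2]
        have h3 : sig z ⟨x, hxt⟩ := hzx
        rw [← heq] at h3
        exact h3
      · exact ⟨Classical.arbitrary K, fun w hw => .inl (by_contra fun hwW => hne ⟨w, hwW, hw⟩)⟩
    calc hausdorffContent K s hs (f ⁻¹' {y}) ≤ hausdorffContent K s hs (W ∪ U x) :=
          measure_mono hx
      _ ≤ hausdorffContent K s hs W + hausdorffContent K s hs (U x) := measure_union_le _ _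
      _ ≤ ε / 2 + ε / 2 :=
          add_le_add hW ((hausdorffContent_le_ediam_rpow hs _).trans (hUd x).le)
      _ = ε := ENNReal.add_halves ε

theorem eventually_residual_hdim_level_le [Nonempty K] {q : ℚ} (hq : 0 < q)
    (hqK : tHdim K - 1 < ((q : ℝ) : EReal)) :
    ∀ᶠ f : C(K, ℝ) in residual C(K, ℝ), ∀ y, hdim (f ⁻¹' {y}) ≤ ((q : ℝ) : EReal) := by
  borelize K
  have hs : (0 : ℝ) < q := by exact_mod_cast hq
  lift (q : ℝ) to NNReal using hs.le with s
  obtain ⟨𝒰, hb, hd⟩ := exists_isTopologicalBasis_of_tHdim_sub_one_lt hqK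
  have hnull : ∀ U ∈ 𝒰, hausdorffContent K s hs (frontier U) = 0 := by
    intro U hU
    have hlt : dimH (frontier U) < s := by
      have h1 := hd U hU
      by_cases h0 : frontier U = ∅
      · simpa [h0] using hs
      · rwa [hdim, if_neg h0, ← EReal.coe_nnreal_eq_coe_real,
          EReal.coe_ennreal_lt_coe_ennreal_iff] at h1
    exact le_antisymm ((hausdorffContent_le_hausdorffMeasure hs _).trans
      (hausdorffMeasure_of_dimH_lt hlt).le) zero_le
  have hn : ∀ᶠ f : C(K, ℝ) in residual C(K, ℝ), ∀ n : ℕ, ∀ y,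
      hausdorffContent K s hs (f ⁻¹' {y}) ≤ (n : ENNReal)⁻¹ :=
    eventually_countable_forall.2 fun n =>
      eventually_residual_hausdorffContent_level_le hs hb hnull (by simp)
  filter_upwards [hn] with f hf y
  have hzero : hausdorffContent K s hs (f ⁻¹' {y}) = 0 :=
    le_antisymm (ge_of_tendsto' ENNReal.tendsto_inv_nat_nhds_zero fun n => hf n y) zero_le
  rw [hdim_le_iff (by exact_mod_cast hs.le)]
  have := dimH_le_of_hausdorffMeasure_ne_top (d := s) (s := f ⁻¹' {y})
    (by simp [hausdorffMeasure_eq_zero_of_hausdorffContent_eq_zero hs hzero])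
  rwa [← EReal.coe_nnreal_eq_coe_real, EReal.coe_ennreal_le_coe_ennreal_iff]

end LevelSets

/-- Let `K` be a compact metric space which is not totally disconnected. Then
for the generic `f ∈ C(K)` the supremum of the Hausdorff dimensions of the level sets of `f` is
attained and equals `dim_tH K − 1`. -/
theorem generic_max_level_set_dimension
    {K : Type*} [MetricSpace K] [CompactSpace K] (hK : ¬ TotallyDisconnectedSpace K) :
    {f : C(K, ℝ) | (∃ y : ℝ, hdim (⇑f ⁻¹' {y}) = tHdim K - 1) ∧
        ∀ y' : ℝ, hdim (⇑f ⁻¹' {y'}) ≤ tHdim K - 1} ∈ residual C(K, ℝ) := by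
  have : Nonempty K := by
    by_contra hE
    rw [not_nonempty_iff] at hE
    exact hK inferInstance
  have h0 : 0 ≤ tHdim K - 1 := zero_le_tHdim_sub_one hK
  obtain ⟨x₀, hx₀⟩ := exists_forall_nhds_exists_not_hasSmallFrontierNhds
    (lt_of_lt_of_le (by decide : (⊥ : EReal) < 0) h0)
  have hupper : ∀ᶠ f : C(K, ℝ) in residual C(K, ℝ), ∀ q : ℚ, tHdim K - 1 < ((q : ℝ) : EReal) →
      ∀ y, hdim (f ⁻¹' {y}) ≤ ((q : ℝ) : EReal) := by
    refine eventually_countable_forall.2 fun q => ?_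
    by_cases hq : tHdim K - 1 < ((q : ℝ) : EReal)
    · have hq0 : 0 < q := by exact_mod_cast h0.trans_lt hq
      filter_upwards [eventually_residual_hdim_level_le hq0 hq] with f hf _ using hf
    · exact .of_forall fun f hf => absurd hf hq
  have hlower : ∀ᶠ f : C(K, ℝ) in residual C(K, ℝ), ∀ q : ℚ, ((q : ℝ) : EReal) < tHdim K - 1 →
      ((q : ℝ) : EReal) ≤ hdim (f ⁻¹' {f x₀}) := by
    refine eventually_countable_forall.2 fun q => ?_
    by_cases hq : ((q : ℝ) : EReal) < tHdim K - 1
    · rcases lt_or_ge ((q : ℝ) : EReal) 0 with hq0 | hq0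
      · exact .of_forall fun f _ => hq0.le.trans (hdim_nonneg ⟨x₀, rfl⟩)
      · refine (eventually_residual_le_hdim_level fun U hU => ?_).mono fun f hf _ => hf
        by_contra! hgood
        obtain ⟨x, hxU, hx⟩ := hx₀ _ hq U hU
        rcases eq_or_ne x x₀ with rfl | hne
        · exact hx (hasSmallFrontierNhds_of_punctured_nhds hq0 hU hgood)
        · exact hx (hgood x hxU hne)
    · exact .of_forall fun f hf => absurd hf hq
  filter_upwards [hupper, hlower] with f hu hl
  have hle : ∀ y, hdim (f ⁻¹' {y}) ≤ tHdim K - 1 := by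
    intro y
    by_contra! hlt
    obtain ⟨q, hq1, hq2⟩ := EReal.lt_iff_exists_rat_btwn.1 hlt
    exact (hu q hq1 y).not_gt hq2
  refine ⟨⟨f x₀, le_antisymm (hle _) ?_⟩, hle⟩
  by_contra! hlt
  obtain ⟨q, hq1, hq2⟩ := EReal.lt_iff_exists_rat_btwn.1 hlt
  exact (hl q hq2).not_gt hq1
end

section
/- Let K be a compact metric space, let K₁ ⊆ K be compact with x₀ ∈ K \ K₁, and let d ∈ ℝ be such that dim_tH B(x, r) > d for every x ∈ K₁ and r > 0 (closed balls taken in K). Then for the generic f ∈ C(K), either dim_H f⁻¹(f(x₀)) ≥ d − 1 or f(x₀) ∉ f(K₁). -/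
open MeasureTheory Topology Metric Set
open scoped Classical

/-- `hdim` is monotone under isometric inclusion of a subspace. -/
theorem hdim_le_of_image_subset {X : Type*} [MetricSpace X] {B : Set X} {s : Set B} {t : Set X}
    (h : Subtype.val '' s ⊆ t) : hdim s ≤ hdim t := by
  rcases s.eq_empty_or_nonempty with rfl | hs
  · unfold hdim
    rw [if_pos rfl]
    split_ifs
    · exact le_rfl
    · exact le_trans (by norm_num) (EReal.coe_ennreal_nonneg _)
  · have ht : t.Nonempty := (hs.image _).mono h
    unfold hdim
    rw [if_neg hs.ne_empty, if_neg ht.ne_empty, EReal.coe_ennreal_le_coe_ennreal_iff,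
      ← isometry_subtype_coe.dimH_image s]
    exact dimH_mono h

/-- If `d < dim_tH X`, then some point has a neighbourhood in which every open neighbourhood of
the point has boundary of dimension greater than `d - 1`. -/
theorem exists_ball_lt_hdim_frontier {X : Type*} [MetricSpace X] [Nonempty X] {d : EReal}
    (h : d < tHdim X) :
    ∃ x : X, ∃ ρ > 0, ∀ U : Set X, IsOpen U → x ∈ U → U ⊆ ball x ρ →
      d - 1 < hdim (frontier U) := by
  by_contra! H
  unfold tHdim at h
  rw [if_pos ‹_›] at h
  refine absurd h (not_lt.2 (sInf_le ⟨{U | IsOpen U ∧ hdim (frontier U) ≤ d - 1}, ?_,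
    fun U hU => hU.2⟩))
  refine TopologicalSpace.isTopologicalBasis_of_isOpen_of_nhds (fun U hU => hU.1) ?_
  intro x V hx hV
  obtain ⟨ρ, hρ, hsub⟩ := Metric.isOpen_iff.1 hV x hx
  obtain ⟨U, hU, hxU, hUρ, hdU⟩ := H x ρ hρ
  exact ⟨U, ⟨hU, hdU⟩, hxU, hUρ.trans hsub⟩

/-- The functions `f` with `f x₀ ∉ f(K₁)` form an open set. -/
theorem isOpen_setOf_apply_notMem_image {K : Type*} [MetricSpace K] [CompactSpace K]
    {K₁ : Set K} (hK₁ : IsClosed K₁) (x₀ : K) :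
    IsOpen {f : C(K, ℝ) | f x₀ ∉ ⇑f '' K₁} := by
  have hcl : IsClosed {p : C(K, ℝ) × K | p.2 ∈ K₁ ∧ p.1 p.2 = p.1 x₀} :=
    (hK₁.preimage continuous_snd).inter (isClosed_eq (by fun_prop) (by fun_prop))
  convert (isClosedMap_fst_of_compactSpace _ hcl).isOpen_compl using 1
  ext f
  simp

/-- A function with `f x₀ = f x₁`, `x₀ ≠ x₁`, where all balls around `x₁` have topological
Hausdorff dimension greater than `d`, can be approximated by functions `g` such that all functions
near `g` have a large level set through `x₀`. -/
theorem exists_dist_le_forall_ball_lt_hdim_fiber {K : Type*} [MetricSpace K] [CompactSpace K]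
    {x₀ x₁ : K} (hne : x₀ ≠ x₁) {d : EReal}
    (hd : ∀ r : ℝ, 0 < r → d < tHdim ↥(closedBall x₁ r))
    (f : C(K, ℝ)) (hf : f x₁ = f x₀) {ε : ℝ} (hε : 0 < ε) :
    ∃ g : C(K, ℝ), dist g f ≤ 2 * ε ∧
      ∀ h ∈ ball g (ε / 2), d - 1 < hdim (⇑h ⁻¹' {h x₀}) := by
  obtain ⟨r₁, hr₁, hclose⟩ := Metric.continuous_iff.1 f.continuous x₁ ε hε
  have hdist : 0 < dist x₀ x₁ := dist_pos.2 hne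
  set δ := dist x₀ x₁ / 2 with hδ
  have hδ0 : 0 < δ := by positivity
  set r := min (r₁ / 2) δ with hr
  have hr0 : 0 < r := lt_min (by positivity) hδ0
  have hnear : ∀ x ∈ closedBall x₁ r, |f x - f x₀| < ε := fun x hx => by
    rw [← hf, ← Real.dist_eq]
    exact hclose x (((mem_closedBall.1 hx).trans (min_le_left _ _)).trans_lt (by linarith))
  have hfar : ∀ x ∈ closedBall x₁ r, δ ≤ dist x x₀ := fun x hx => by
    have h₁ := (mem_closedBall.1 hx).trans (min_le_right _ _)
    have h₂ := dist_triangle x₀ x x₁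
    rw [dist_comm x₀ x] at h₂
    linarith
  have : Nonempty ↥(closedBall x₁ r) := ⟨⟨x₁, mem_closedBall_self hr0.le⟩⟩
  obtain ⟨x₂, ρ, hρ, hU⟩ := exists_ball_lt_hdim_frontier (hd r hr0)
  let a : K → ℝ := fun x => min 1 (dist x x₂ / ρ)
  let φ : K → ℝ := fun x => f x₀ + (2 * a x - 1) * ε * min 1 (dist x x₀ / δ)
  have hφ : Continuous φ := by fun_prop
  have ha0 : ∀ x, 0 ≤ a x := fun x => le_min zero_le_one (by positivity)
  have ha1 : ∀ x, a x ≤ 1 := fun x => min_le_left _ _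
  let g : C(K, ℝ) := ⟨fun x => max (f x - 2 * ε) (min (f x + 2 * ε) (φ x)), by fun_prop⟩
  have hgφ : ∀ x, |φ x - f x| ≤ 2 * ε → g x = φ x := fun x hx => by
    have := abs_le.1 hx
    change max (f x - 2 * ε) (min (f x + 2 * ε) (φ x)) = φ x
    rw [min_eq_right (by linarith), max_eq_right (by linarith)]
  have hg₀ : g x₀ = f x₀ := by
    have : φ x₀ = f x₀ := by simp [φ]
    rw [hgφ x₀ (by rw [this, sub_self, abs_zero]; positivity), this]
  have hgB : ∀ x ∈ closedBall x₁ r, g x = f x₀ + (2 * a x - 1) * ε := fun x hx => by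
    have h₁ : φ x = f x₀ + (2 * a x - 1) * ε := by
      simp only [φ]
      rw [min_eq_left ((one_le_div hδ0).2 (hfar x hx)), mul_one]
    rw [hgφ x, h₁]
    have h₂ := abs_lt.1 (hnear x hx)
    rw [h₁, abs_le]
    constructor <;> nlinarith [ha0 x, ha1 x]
  refine ⟨g, (ContinuousMap.dist_le (by positivity)).2 fun x => ?_, fun h hh => ?_⟩
  · rw [Real.dist_eq, abs_le]
    change -(2 * ε) ≤ max (f x - 2 * ε) (min (f x + 2 * ε) (φ x)) - f x ∧
      max (f x - 2 * ε) (min (f x + 2 * ε) (φ x)) - f x ≤ 2 * ε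
    constructor
    · linarith [le_max_left (f x - 2 * ε) (min (f x + 2 * ε) (φ x))]
    · linarith [max_le (by linarith : f x - 2 * ε ≤ f x + 2 * ε)
        (min_le_left (f x + 2 * ε) (φ x))]
  have hhg : ∀ x, |h x - g x| < ε / 2 := fun x => by
    rw [← Real.dist_eq]
    exact (ContinuousMap.dist_apply_le_dist x).trans_lt hh
  have h₀ := abs_lt.1 (hhg x₀)
  rw [hg₀] at h₀
  let U : Set ↥(closedBall x₁ r) := {x | h x < h x₀}
  have hcont : Continuous fun x : ↥(closedBall x₁ r) => h x := by fun_prop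
  refine (hU U (isOpen_lt hcont continuous_const) ?_ ?_).trans_le (hdim_le_of_image_subset ?_)
  · have h₂ := abs_lt.1 (hhg x₂)
    have ha : a x₂ = 0 := by simp [a]
    rw [hgB x₂ x₂.2, ha] at h₂
    change h x₂ < h x₀
    linarith
  · intro x hx
    by_contra hxρ
    have hle : ρ ≤ dist (x : K) x₂ := not_lt.1 hxρ
    have ha : a x = 1 := min_eq_left ((one_le_div hρ).2 hle)
    have h₂ := abs_lt.1 (hhg x)
    rw [hgB x x.2, ha] at h₂
    have hx' : h x < h x₀ := hx
    linarith
  · rintro _ ⟨x, hx, rfl⟩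
    exact frontier_lt_subset_eq hcont continuous_const hx

/-- Let `K` be a compact metric space, `K₁ ⊆ K` compact, `x₀ ∈ K \ K₁` and
`d ∈ ℝ` such that `dim_tH B(x, r) > d` for every `x ∈ K₁` and `r > 0`. Then for the generic
`f ∈ C(K)`, either `dim_H f⁻¹(f(x₀)) ≥ d − 1` or `f(x₀) ∉ f(K₁)`. -/
theorem generic_level_dim_ge_or_not_mem
    {K : Type*} [MetricSpace K] [CompactSpace K] (K₁ : Set K) (hK₁ : IsCompact K₁)
    (x₀ : K) (hx₀ : x₀ ∉ K₁) (d : ℝ)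
    (hd : ∀ x ∈ K₁, ∀ r : ℝ, 0 < r → (d : EReal) < tHdim ↥(closedBall x r)) :
    {f : C(K, ℝ) | (d : EReal) - 1 ≤ hdim (⇑f ⁻¹' {f x₀}) ∨ f x₀ ∉ ⇑f '' K₁} ∈
      residual C(K, ℝ) := by
  have hopen := isOpen_setOf_apply_notMem_image hK₁.isClosed x₀
  refine Filter.mem_of_superset (residual_of_dense_open isOpen_interior ?_) interior_subset
  intro f
  by_cases hfx : f x₀ ∈ ⇑f '' K₁
  · obtain ⟨x₁, hx₁, hf⟩ := hfx
    refine Metric.mem_closure_iff.2 fun η hη => ?_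
    obtain ⟨g, hgf, hg⟩ := exists_dist_le_forall_ball_lt_hdim_fiber
      (ne_of_mem_of_not_mem hx₁ hx₀).symm (hd x₁ hx₁) f hf (ε := η / 3) (by positivity)
    refine ⟨g, mem_interior.2 ⟨ball g (η / 3 / 2), fun h hh => Or.inl (hg h hh).le,
      isOpen_ball, mem_ball_self (by positivity)⟩, ?_⟩
    rw [dist_comm]
    linarith
  · exact subset_closure (interior_maximal (fun _ h => Or.inr h) hopen hfx)
end
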